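/- arXiv:2111.12171 — 5 statements merged into one kernel-verified Lean document; each statement's English description precedes it below -/
import Mathlib

section
/- Let 0 < ε < 1 and let g : ℝ → ℝ → ℝ be such that g(0, θ) = θ for all θ, for each θ the map s ↦ g(s, θ) is infinitely differentiable on (−ε, ε), and f(s, g(s, θ)) = θ for all θ ∈ ℝ and all s with |s| < ε, where f(s, φ) = (π/2) · (∫₀^φ (1 − s·sin²τ)^(−1/2) dτ) / (∫₀^{π/2} (1 − s·sin²τ)^(−1/2) dτ). Then for every integer j ≥ 1, (1/(π · j!)) · ∫_{−π}^{π} (∂_s^j g)(0, θ) · sin(2jθ) dθ = 2/(2^{4j} · j). -/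
open Real MeasureTheory intervalIntegral ContDiff

/-- The action-angle coordinate `θ` as a function of the elliptic coordinate `φ`
and the caustic parameter `s = k_λ²`. -/
noncomputable def actionAngle (s φ : ℝ) : ℝ :=
  (π / 2) * (∫ τ in (0:ℝ)..φ, (1 - s * Real.sin τ ^ 2) ^ (-(1:ℝ)/2)) /
    (∫ τ in (0:ℝ)..(π/2), (1 - s * Real.sin τ ^ 2) ^ (-(1:ℝ)/2))



section ParametricIntegral

theorem hasFDerivAt_intervalIntegral_of_contDiffOn {E G : Type} [NormedAddCommGroup E]
    [NormedSpace ℝ E] [ProperSpace E] [NormedAddCommGroup G] [NormedSpace ℝ G]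
    {U : Set E} (hU : IsOpen U) {F : E × ℝ → G}
    (hF : ContDiffOn ℝ 1 F (U ×ˢ Set.univ)) {a b : ℝ} {x₀ : E} (hx₀ : x₀ ∈ U) :
    HasFDerivAt (fun x => ∫ t in a..b, F (x, t))
      (∫ t in a..b, (fderiv ℝ F (x₀, t)).comp (ContinuousLinearMap.inl ℝ E ℝ)) x₀ := by
  have hO : IsOpen (U ×ˢ (Set.univ : Set ℝ)) := hU.prod isOpen_univ
  have hslice : ∀ x ∈ U, Continuous fun t : ℝ => F (x, t) := fun x hx =>
    hF.continuousOn.comp_continuous (by fun_prop) fun t => ⟨hx, trivial⟩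
  have hF' : ContinuousOn (fun p => (fderiv ℝ F p).comp (ContinuousLinearMap.inl ℝ E ℝ))
      (U ×ˢ (Set.univ : Set ℝ)) :=
    (hF.continuousOn_fderiv_of_isOpen hO le_rfl).clm_comp continuousOn_const
  obtain ⟨r, hr, hball⟩ := Metric.nhds_basis_closedBall.mem_iff.1 (hU.mem_nhds hx₀)
  obtain ⟨C, hC⟩ := ((isCompact_closedBall x₀ r).prod (isCompact_uIcc (a := a) (b := b))).bddAbove_image
    (f := fun p => ‖(fderiv ℝ F p).comp (ContinuousLinearMap.inl ℝ E ℝ)‖)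
    (hF'.mono (Set.prod_mono hball (Set.subset_univ _))).norm
  refine hasFDerivAt_integral_of_dominated_of_fderiv_le
    (F' := fun x t => (fderiv ℝ F (x, t)).comp (ContinuousLinearMap.inl ℝ E ℝ))
    (bound := fun _ => C) (Metric.closedBall_mem_nhds x₀ hr) ?_ ?_ ?_ ?_ ?_ ?_
  · filter_upwards [hU.mem_nhds hx₀] with x hx
    exact (hslice x hx).aestronglyMeasurable
  · exact (hslice x₀ hx₀).intervalIntegrable _ _
  · exact (hF'.comp_continuous (f := fun t : ℝ => (x₀, t)) (by fun_prop)
      fun t => ⟨hx₀, trivial⟩).aestronglyMeasurable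
  · refine Filter.Eventually.of_forall fun t ht x hx => ?_
    exact hC ⟨(x, t), ⟨hx, Set.uIoc_subset_uIcc ht⟩, rfl⟩
  · exact intervalIntegrable_const
  · refine Filter.Eventually.of_forall fun t ht x hx => ?_
    have hd : HasFDerivAt F (fderiv ℝ F (x, t)) (x, t) :=
      ((hF.differentiableOn one_ne_zero).differentiableAt
        (hO.mem_nhds ⟨hball hx, trivial⟩)).hasFDerivAt
    exact hd.comp x (hasFDerivAt_prodMk_left x t)

theorem contDiffOn_nat_intervalIntegral {E : Type} [NormedAddCommGroup E] [NormedSpace ℝ E]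
    [ProperSpace E] {U : Set E} (hU : IsOpen U) (a b : ℝ) (n : ℕ) :
    ∀ {G : Type} [NormedAddCommGroup G] [NormedSpace ℝ G] {F : E × ℝ → G},
      ContDiffOn ℝ ∞ F (U ×ˢ Set.univ) →
      ContDiffOn ℝ n (fun x => ∫ t in a..b, F (x, t)) U := by
  have hO : IsOpen (U ×ˢ (Set.univ : Set ℝ)) := hU.prod isOpen_univ
  induction n with
  | zero =>
    intro G _ _ F hF
    refine contDiffOn_zero.2 fun x hx => ?_
    exact (hasFDerivAt_intervalIntegral_of_contDiffOn hU (hF.of_le (mod_cast le_top))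
      hx).continuousAt.continuousWithinAt
  | succ n ih =>
    intro G _ _ F hF
    have hd := fun x hx => hasFDerivAt_intervalIntegral_of_contDiffOn (a := a) (b := b) (x₀ := x)
      hU (hF.of_le (mod_cast le_top)) hx
    push_cast
    rw [contDiffOn_succ_iff_fderiv_of_isOpen hU]
    refine ⟨fun x hx => (hd x hx).differentiableAt.differentiableWithinAt, by simp, ?_⟩
    refine (ih (F := fun p => (fderiv ℝ F p).comp (ContinuousLinearMap.inl ℝ E ℝ)) ?_).congr
      fun x hx => (hd x hx).fderiv
    exact ((contDiffOn_infty_iff_fderiv_of_isOpen hO).1 hF).2.clm_comp contDiffOn_const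

theorem contDiffOn_intervalIntegral {E G : Type} [NormedAddCommGroup E] [NormedSpace ℝ E]
    [ProperSpace E] [NormedAddCommGroup G] [NormedSpace ℝ G] {U : Set E} (hU : IsOpen U)
    (a b : ℝ) {F : E × ℝ → G} (hF : ContDiffOn ℝ ∞ F (U ×ˢ Set.univ)) :
    ContDiffOn ℝ ∞ (fun x => ∫ t in a..b, F (x, t)) U :=
  contDiffOn_infty.2 fun n => contDiffOn_nat_intervalIntegral hU a b n hF

end ParametricIntegral

theorem eq_of_tendsto_sum_pow_div (n : ℕ) (a : ℕ → ℝ) (c : ℝ)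
    (h : Filter.Tendsto (fun s : ℝ => (∑ k ∈ Finset.range (n + 1), a k * s ^ k) / s ^ n)
      (nhdsWithin 0 (Set.Ioi 0)) (nhds c)) : a n = c := by
  induction n generalizing a with
  | zero => exact tendsto_nhds_unique (by simp) h
  | succ n ih =>
    have hpow : Filter.Tendsto (fun s : ℝ => s ^ (n + 1)) (nhdsWithin 0 (Set.Ioi 0)) (nhds 0) :=
      ((continuous_pow (n + 1)).tendsto' 0 0 (by simp)).mono_left nhdsWithin_le_nhds
    have hpoly : Filter.Tendsto (fun s : ℝ => ∑ k ∈ Finset.range (n + 1 + 1), a k * s ^ k)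
        (nhdsWithin 0 (Set.Ioi 0)) (nhds (a 0)) := by
      refine Filter.Tendsto.mono_left (Continuous.tendsto' (by fun_prop) 0 _ ?_) nhdsWithin_le_nhds
      simp [Finset.sum_range_succ']
    have ha : a 0 = 0 := by
      refine tendsto_nhds_unique hpoly ?_
      have := h.mul hpow
      rw [mul_zero] at this
      refine this.congr' ?_
      filter_upwards [self_mem_nhdsWithin] with s hs
      exact div_mul_cancel₀ _ (pow_ne_zero _ (ne_of_gt hs))
    refine ih (fun k => a (k + 1)) (h.congr' ?_)
    filter_upwards [self_mem_nhdsWithin] with s hs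
    have hs0 : s ≠ 0 := ne_of_gt hs
    rw [Finset.sum_range_succ', ha, pow_succ s n, zero_mul, add_zero,
      ← mul_div_mul_right _ (s ^ n) hs0, Finset.sum_mul]
    simp only [pow_succ, mul_assoc]

section Recurrence

open Filter Asymptotics Topology

variable {j : ℕ} {b D : ℝ → ℕ → ℝ} {A B d : ℕ → ℝ}

theorem isBigO_pow_of_recurrence
    (hbdd : ∀ m, (fun s => b s m) =O[𝓝[>] (0 : ℝ)] (1 : ℝ → ℝ))
    (hD : ∀ m < j, Tendsto (fun s => D s m) (𝓝[>] 0) (𝓝 (d m))) (hd : ∀ m < j, d m ≠ 0)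
    (hrec : ∀ m < j, ∀ᶠ s in 𝓝[>] (0 : ℝ),
      D s m * b s m = s * (A m * b s (m - 1) + B m * b s (m + 1))) (r : ℕ) :
    ∀ m, m + r ≤ j → (fun s => b s m) =O[𝓝[>] (0 : ℝ)] fun s => s ^ r := by
  induction r with
  | zero => intro m _; simp only [pow_zero]; exact hbdd m
  | succ r ih =>
    intro m hm
    have hmj : m < j := by omega
    have hO : (fun s => (D s m)⁻¹ * (s * (A m * b s (m - 1) + B m * b s (m + 1))))
        =O[𝓝[>] (0 : ℝ)] fun s => 1 * (s * s ^ r) :=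
      (((hD m hmj).inv₀ (hd m hmj)).isBigO_one ℝ).mul ((isBigO_refl _ _).mul
        (((ih (m - 1) (by omega)).const_mul_left _).add
          ((ih (m + 1) (by omega)).const_mul_left _)))
    refine (hO.congr_right fun s => by ring).congr' ?_ EventuallyEq.rfl
    filter_upwards [hrec m hmj, (hD m hmj).eventually_ne (hd m hmj)] with s hs hs0
    rw [← hs, inv_mul_cancel_left₀ hs0]

theorem tendsto_div_pow_of_recurrence {L : ℝ}
    (hbdd : ∀ m, (fun s => b s m) =O[𝓝[>] (0 : ℝ)] (1 : ℝ → ℝ))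
    (hD : ∀ m < j, Tendsto (fun s => D s m) (𝓝[>] 0) (𝓝 (d m))) (hd : ∀ m < j, d m ≠ 0)
    (hrec : ∀ m < j, ∀ᶠ s in 𝓝[>] (0 : ℝ),
      D s m * b s m = s * (A m * b s (m - 1) + B m * b s (m + 1)))
    (hL : Tendsto (fun s => b s j) (𝓝[>] 0) (𝓝 L)) :
    Tendsto (fun s => b s 0 / s ^ j) (𝓝[>] 0) (𝓝 (L * ∏ k ∈ Finset.range j, B k / d k)) := by
  suffices H : ∀ i m, m + i = j → Tendsto (fun s => b s m / s ^ i) (𝓝[>] 0)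
      (𝓝 (L * ∏ k ∈ Finset.range i, B (m + k) / d (m + k))) by
    simpa using H j 0 (by simp)
  intro i
  induction i with
  | zero => rintro m rfl; simpa using hL
  | succ i ih =>
    intro m hm
    have hmj : m < j := by omega
    have hsmall : Tendsto (fun s => b s (m - 1) / s ^ i) (𝓝[>] 0) (𝓝 0) := by
      refine IsLittleO.tendsto_div_nhds_zero ?_
      refine (isBigO_pow_of_recurrence hbdd hD hd hrec (i + 1) (m - 1) (by omega)).trans_isLittleO ?_
      exact (isLittleO_pow_pow i.lt_succ_self).mono nhdsWithin_le_nhds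
    have hlim := ((hD m hmj).inv₀ (hd m hmj)).mul
      ((hsmall.const_mul (A m)).add ((ih (m + 1) (by omega)).const_mul (B m)))
    rw [Finset.prod_range_succ']
    convert hlim.congr' ?_ using 2
    · simp only [mul_zero, zero_add, add_zero, add_assoc, add_comm 1]
      ring
    · filter_upwards [hrec m hmj, (hD m hmj).eventually_ne (hd m hmj), self_mem_nhdsWithin]
        with s hs hs0 hpos
      have hs' : s ≠ 0 := ne_of_gt hpos
      have : b s m = (D s m)⁻¹ * (s * (A m * b s (m - 1) + B m * b s (m + 1))) := by
        rw [← hs, inv_mul_cancel_left₀ hs0]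
      rw [this, pow_succ]
      field_simp

end Recurrence

theorem prod_sub_mul_add_mul_factorial (j i : ℕ) (hi : i ≤ j) :
    (∏ k ∈ Finset.range i, ((j : ℝ) - k) * (j + k)) * (j - i).factorial * (j + i)
      = j * (j + i).factorial := by
  induction i with
  | zero => simp; ring
  | succ i ih =>
    have h := ih (by omega)
    have h1 : j - i = (j - (i + 1)) + 1 := by omega
    rw [h1, Nat.factorial_succ] at h
    have h2 : ((j - (i + 1) + 1 : ℕ) : ℝ) = j - i := by
      rw [← h1, Nat.cast_sub (by omega)]
    rw [Nat.cast_mul, h2] at h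
    rw [Finset.prod_range_succ, ← add_assoc, Nat.factorial_succ]
    push_cast
    linear_combination (j + i + 1 : ℝ) * h

theorem prod_succ_mul_add_half (i : ℕ) :
    ∏ k ∈ Finset.range i, ((k : ℝ) + 1) * (k + 1 / 2) = (2 * i).factorial / 4 ^ i := by
  induction i with
  | zero => simp
  | succ i ih =>
    rw [Finset.prod_range_succ, ih, show 2 * (i + 1) = 2 * i + 1 + 1 by ring, Nat.factorial_succ,
      Nat.factorial_succ]
    push_cast
    field_simp
    ring

theorem prod_recurrence_ratio (j : ℕ) (hj : 1 ≤ j) :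
    ∏ k ∈ Finset.range j, ((if k = 0 then 2 else 1) * (((k : ℝ) + 1) * (k + 1 / 2))) /
      (4 * ((j : ℝ) ^ 2 - k ^ 2)) = 4 / 16 ^ j := by
  have hj0 : (j : ℝ) ≠ 0 := by positivity
  have h1 := prod_sub_mul_add_mul_factorial j j le_rfl
  have h2 : ∏ k ∈ Finset.range j, ((j : ℝ) ^ 2 - k ^ 2) = (2 * j).factorial / 2 := by
    have h3 : ∀ k : ℕ, (j : ℝ) ^ 2 - k ^ 2 = (j - k) * (j + k) := fun k => by ring
    simp only [h3]
    rw [Nat.sub_self, ← two_mul, ← two_mul] at h1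
    simp only [Nat.factorial_zero, Nat.cast_one, mul_one] at h1
    rw [eq_div_iff two_ne_zero]
    apply mul_right_cancel₀ hj0
    linear_combination h1
  have h4 : ∏ k ∈ Finset.range j, (if k = 0 then (2 : ℝ) else 1) = 2 := by
    rw [Finset.prod_ite_eq']
    simp; omega
  rw [Finset.prod_div_distrib, Finset.prod_mul_distrib, prod_succ_mul_add_half,
    Finset.prod_mul_distrib, h2, h4]
  have := Nat.factorial_ne_zero (2 * j)
  simp only [Finset.prod_const, Finset.card_range]
  rw [show (16 : ℝ) = 4 * 4 by norm_num, mul_pow]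
  field_simp
  norm_num

theorem integral_cos_phase_recurrence {s κ : ℝ} {F r : ℝ → ℝ} (j m : ℕ)
    (hr : ∀ x, r x ^ 2 * (1 - s * sin x ^ 2) = 1)
    (hr' : ∀ x, HasDerivAt r (s * sin x * cos x * r x ^ 3) x)
    (hF : ∀ x, HasDerivAt F (κ * r x) x) (hFπ : F π = π) (hFnegπ : F (-π) = -π) :
    4 * (κ ^ 2 * j ^ 2 - m ^ 2 * (1 - s / 2)) *
        (∫ x in (-π)..π, cos (2 * j * F x) * cos (2 * m * x)) =
      s * ((m - 1) * (m - 1 / 2) * (∫ x in (-π)..π, cos (2 * j * F x) * cos (2 * (m - 1) * x)) +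
        (m + 1) * (m + 1 / 2) * (∫ x in (-π)..π, cos (2 * j * F x) * cos (2 * (m + 1) * x))) := by
  have hFc : Continuous F := continuous_iff_continuousAt.2 fun x => (hF x).continuousAt
  have hsin : ∀ n : ℕ, sin (2 * n * π) = 0 := fun n => by
    rw [← Nat.cast_ofNat, ← Nat.cast_mul]; exact sin_nat_mul_pi _
  -- The primitive is the bilinear concomitant of the second order equation satisfied by
  -- `cos (2 * j * F x)` and the test function `cos (2 * m * x)`.
  let W : ℝ → ℝ := fun x =>
    (1 - s * sin x ^ 2) * cos (2 * m * x) * (-(2 * j * κ) * r x * sin (2 * j * F x)) +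
      (s * sin x * cos x * cos (2 * m * x) +
        (1 - s * sin x ^ 2) * (2 * m * sin (2 * m * x))) * cos (2 * j * F x)
  let W' : ℝ → ℝ := fun x =>
    s * ((m - 1) * (m - 1 / 2) * (cos (2 * j * F x) * cos (2 * (m - 1) * x)) +
        (m + 1) * (m + 1 / 2) * (cos (2 * j * F x) * cos (2 * (m + 1) * x))) -
      4 * (κ ^ 2 * j ^ 2 - m ^ 2 * (1 - s / 2)) * (cos (2 * j * F x) * cos (2 * m * x))
  have hW : ∀ x, HasDerivAt W (W' x) x := by
    intro x
    have hs := hasDerivAt_sin x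
    have hc := hasDerivAt_cos x
    have hp := ((hs.pow 2).const_mul s).const_sub 1
    have hm := (hasDerivAt_id x).const_mul (2 * (m : ℝ))
    have hj := (hF x).const_mul (2 * (j : ℝ))
    have h := ((hp.mul hm.cos).mul (((hr' x).const_mul (-(2 * j * κ))).mul hj.sin)).add
      (((((hs.const_mul s).mul hc).mul hm.cos).add
        (hp.mul (hm.sin.const_mul (2 * (m : ℝ))))).mul hj.cos)
    refine h.congr_deriv ?_
    have e1 : cos (2 * ((m : ℝ) - 1) * x) = cos (2 * m * x) * cos (2 * x)
        + sin (2 * m * x) * sin (2 * x) := by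
      rw [← cos_sub]; ring_nf
    have e2 : cos (2 * ((m : ℝ) + 1) * x) = cos (2 * m * x) * cos (2 * x)
        - sin (2 * m * x) * sin (2 * x) := by
      rw [← cos_add]; ring_nf
    simp only [W', e1, e2, cos_two_mul, sin_two_mul, id, Pi.pow_apply, Pi.mul_apply, Pi.add_apply]
    have h1 := hr x
    have h2 : cos x ^ 2 = 1 - sin x ^ 2 := cos_sq' x
    linear_combination (-(2 * j * κ) * cos (2 * m * x) * sin (2 * j * F x) * s * sin x * cos x * r x
      - 4 * j ^ 2 * κ ^ 2 * cos (2 * m * x) * cos (2 * j * F x)) * h1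
      - s * (4 * m ^ 2 + 1) * cos (2 * m * x) * cos (2 * j * F x) * h2
  have hint := integral_eq_sub_of_hasDerivAt (f := W) (a := -π) (b := π)
    (fun x _ => hW x) (Continuous.intervalIntegrable (by fun_prop) _ _)
  have hW0 : W π - W (-π) = 0 := by
    simp only [W, hFπ, hFnegπ, mul_neg, sin_neg, cos_neg, hsin]
    simp
  rw [hW0] at hint
  simp only [W'] at hint
  rw [intervalIntegral.integral_sub, intervalIntegral.integral_const_mul,
    intervalIntegral.integral_add, intervalIntegral.integral_const_mul,
    intervalIntegral.integral_const_mul, intervalIntegral.integral_const_mul] at hint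
  · linarith
  all_goals exact Continuous.intervalIntegrable (by fun_prop) _ _
theorem one_sub_mul_sin_sq_pos {s : ℝ} (hs : |s| < 1) (τ : ℝ) : 0 < 1 - s * sin τ ^ 2 := by
  have h : s * sin τ ^ 2 ≤ |s| := calc
    s * sin τ ^ 2 ≤ |s| * sin τ ^ 2 := by gcongr; exact le_abs_self s
    _ ≤ |s| := mul_le_of_le_one_right (abs_nonneg s) (sin_sq_le_one τ)
  linarith

/-- The integrand of the incomplete elliptic integral of the first kind with parameter `s`. -/
noncomputable def ellipticIntegrand (s τ : ℝ) : ℝ := (1 - s * sin τ ^ 2) ^ (-(1:ℝ)/2)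

/-- The domain of regularity of `actionAngle`, as a function of the pair `(s, φ)`. -/
def ellipticDomain : Set (ℝ × ℝ) := {p | |p.1| < 1}

theorem isOpen_ellipticDomain : IsOpen ellipticDomain :=
  isOpen_lt (by fun_prop) continuous_const

section Integrand

variable {s : ℝ}

theorem ellipticIntegrand_pos (hs : |s| < 1) (τ : ℝ) : 0 < ellipticIntegrand s τ :=
  rpow_pos_of_pos (one_sub_mul_sin_sq_pos hs τ) _

theorem ellipticIntegrand_sq_mul (hs : |s| < 1) (τ : ℝ) :
    ellipticIntegrand s τ ^ 2 * (1 - s * sin τ ^ 2) = 1 := by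
  have h := one_sub_mul_sin_sq_pos hs τ
  rw [ellipticIntegrand, ← rpow_natCast, ← rpow_mul h.le]
  norm_num
  rw [rpow_neg_one, inv_mul_cancel₀ h.ne']

theorem hasDerivAt_ellipticIntegrand (hs : |s| < 1) (τ : ℝ) :
    HasDerivAt (ellipticIntegrand s) (s * sin τ * cos τ * ellipticIntegrand s τ ^ 3) τ := by
  have h := one_sub_mul_sin_sq_pos hs τ
  refine (((((hasDerivAt_sin τ).pow 2).const_mul s).const_sub 1).rpow_const
    (p := -(1:ℝ)/2) (Or.inl h.ne')).congr_deriv ?_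
  have e : ellipticIntegrand s τ ^ 3 = (1 - s * sin τ ^ 2) ^ (-(1:ℝ)/2 - 1) := by
    rw [ellipticIntegrand, ← rpow_natCast, ← rpow_mul h.le]
    norm_num
  rw [e]
  simp
  ring

theorem continuous_ellipticIntegrand (hs : |s| < 1) : Continuous (ellipticIntegrand s) :=
  continuous_iff_continuousAt.2 fun τ => (hasDerivAt_ellipticIntegrand hs τ).continuousAt

theorem ellipticIntegrand_neg (s τ : ℝ) : ellipticIntegrand s (-τ) = ellipticIntegrand s τ := by
  simp [ellipticIntegrand]

theorem ellipticIntegrand_pi_sub (s τ : ℝ) :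
    ellipticIntegrand s (π - τ) = ellipticIntegrand s τ := by
  simp [ellipticIntegrand]

theorem completeIntegral_pos (hs : |s| < 1) : 0 < ∫ τ in (0:ℝ)..(π/2), ellipticIntegrand s τ :=
  intervalIntegral_pos_of_pos ((continuous_ellipticIntegrand hs).intervalIntegrable _ _)
    (ellipticIntegrand_pos hs) (by positivity)

theorem actionAngle_eq (s φ : ℝ) : actionAngle s φ =
    (π / 2) * (∫ τ in (0:ℝ)..φ, ellipticIntegrand s τ) /
      (∫ τ in (0:ℝ)..(π/2), ellipticIntegrand s τ) := rfl

/-- The normalizing factor `π / (2 K(s))` of the action-angle coordinate. -/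
noncomputable def angleFactor (s : ℝ) : ℝ :=
  (π / 2) / ∫ τ in (0:ℝ)..(π/2), ellipticIntegrand s τ

theorem angleFactor_pos (hs : |s| < 1) : 0 < angleFactor s :=
  div_pos (by positivity) (completeIntegral_pos hs)

theorem hasDerivAt_actionAngle (hs : |s| < 1) (φ : ℝ) :
    HasDerivAt (actionAngle s) (angleFactor s * ellipticIntegrand s φ) φ := by
  have hc := continuous_ellipticIntegrand hs
  refine (((integral_hasDerivAt_right (hc.intervalIntegrable 0 φ)
    hc.stronglyMeasurable.stronglyMeasurableAtFilter hc.continuousAt).const_mul (π / 2)).div_const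
      (∫ τ in (0:ℝ)..(π/2), ellipticIntegrand s τ)).congr_deriv ?_
  rw [angleFactor]
  ring

theorem continuous_actionAngle (hs : |s| < 1) : Continuous (actionAngle s) :=
  continuous_iff_continuousAt.2 fun φ => (hasDerivAt_actionAngle hs φ).continuousAt

theorem strictMono_actionAngle (hs : |s| < 1) : StrictMono (actionAngle s) :=
  strictMono_of_deriv_pos fun φ => by
    rw [(hasDerivAt_actionAngle hs φ).deriv]
    exact mul_pos (angleFactor_pos hs) (ellipticIntegrand_pos hs φ)

theorem actionAngle_pi (hs : |s| < 1) : actionAngle s π = π := by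
  have hc := continuous_ellipticIntegrand hs
  have h : ∫ τ in (π/2)..π, ellipticIntegrand s τ = ∫ τ in (0:ℝ)..(π/2), ellipticIntegrand s τ := by
    have := intervalIntegral.integral_comp_sub_left (a := 0) (b := π / 2) (ellipticIntegrand s) π
    simp only [ellipticIntegrand_pi_sub, sub_zero, sub_half] at this
    exact this.symm
  rw [actionAngle_eq, ← integral_add_adjacent_intervals (hc.intervalIntegrable 0 (π / 2))
    (hc.intervalIntegrable (π / 2) π), h]
  have := (completeIntegral_pos hs).ne'
  field_simp
  ring

theorem actionAngle_neg (s φ : ℝ) : actionAngle s (-φ) = -actionAngle s φ := by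
  have := intervalIntegral.integral_comp_neg (a := 0) (b := φ) (ellipticIntegrand s)
  simp only [ellipticIntegrand_neg, neg_zero] at this
  rw [actionAngle_eq, actionAngle_eq, integral_symm, ← this]
  ring

theorem actionAngle_zero_left (φ : ℝ) : actionAngle 0 φ = φ := by
  simp [actionAngle]

theorem angleFactor_zero : angleFactor 0 = 1 := by
  simp [angleFactor, ellipticIntegrand]

end Integrand

theorem contDiffOn_incompleteIntegral :
    ContDiffOn ℝ ∞ (fun p : ℝ × ℝ => ∫ τ in (0:ℝ)..p.2, ellipticIntegrand p.1 τ)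
      ellipticDomain := by
  have h : ContDiffOn ℝ ∞ (fun q : (ℝ × ℝ) × ℝ => ellipticIntegrand q.1.1 (q.1.2 * q.2))
      (ellipticDomain ×ˢ Set.univ) := by
    refine ContDiffOn.rpow_const_of_ne (ContDiff.contDiffOn (by fun_prop)) fun q hq => ?_
    exact (one_sub_mul_sin_sq_pos hq.1 _).ne'
  refine (contDiffOn_snd.mul (contDiffOn_intervalIntegral isOpen_ellipticDomain 0 1 h)).congr
    fun p _ => ?_
  simp only [intervalIntegral.mul_integral_comp_mul_left, mul_zero, mul_one]

theorem contDiffOn_completeIntegral :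
    ContDiffOn ℝ ∞ (fun p : ℝ × ℝ => ∫ τ in (0:ℝ)..(π/2), ellipticIntegrand p.1 τ)
      ellipticDomain :=
  contDiffOn_incompleteIntegral.comp (f := fun p : ℝ × ℝ => (p.1, π / 2))
    (ContDiff.contDiffOn (by fun_prop)) fun _ hp => hp

theorem contDiffOn_actionAngle :
    ContDiffOn ℝ ∞ (fun p : ℝ × ℝ => actionAngle p.1 p.2) ellipticDomain :=
  (contDiffOn_const.mul contDiffOn_incompleteIntegral).div contDiffOn_completeIntegral
    fun _ hp => (completeIntegral_pos hp).ne'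

theorem continuousAt_angleFactor_zero : ContinuousAt angleFactor 0 := by
  have h : ContinuousAt (fun p : ℝ × ℝ => ∫ τ in (0:ℝ)..(π/2), ellipticIntegrand p.1 τ) (0, 0) :=
    contDiffOn_completeIntegral.continuousOn.continuousAt
      (isOpen_ellipticDomain.mem_nhds (by simp [ellipticDomain]))
  have h' : ContinuousAt (fun s : ℝ => ∫ τ in (0:ℝ)..(π/2), ellipticIntegrand s τ) 0 :=
    ContinuousAt.comp (f := fun s : ℝ => (s, (0 : ℝ))) h (by fun_prop)
  exact continuousAt_const.div h' (completeIntegral_pos (by simp)).ne'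

/-- The velocity `∂φ/∂s` of the elliptic coordinate along a level set of `actionAngle`. -/
noncomputable def levelVelocity (p : ℝ × ℝ) : ℝ :=
  -(fderiv ℝ (fun p : ℝ × ℝ => actionAngle p.1 p.2) p (1, 0)) /
    fderiv ℝ (fun p : ℝ × ℝ => actionAngle p.1 p.2) p (0, 1)

/-- The `k`-th derivative of the elliptic coordinate along a level set of `actionAngle`, as a
function on the `(s, φ)`-plane. -/
noncomputable def levelDeriv : ℕ → ℝ × ℝ → ℝ
  | 0, p => p.2
  | k + 1, p => fderiv ℝ (levelDeriv k) p (1, levelVelocity p)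

theorem hasFDerivAt_actionAngle {p : ℝ × ℝ} (hp : p ∈ ellipticDomain) :
    HasFDerivAt (fun p : ℝ × ℝ => actionAngle p.1 p.2)
      (fderiv ℝ (fun p : ℝ × ℝ => actionAngle p.1 p.2) p) p :=
  ((contDiffOn_actionAngle.contDiffAt (isOpen_ellipticDomain.mem_nhds hp)).differentiableAt
    (by simp)).hasFDerivAt

theorem fderiv_actionAngle_snd_pos {p : ℝ × ℝ} (hp : p ∈ ellipticDomain) :
    0 < fderiv ℝ (fun p : ℝ × ℝ => actionAngle p.1 p.2) p (0, 1) := by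
  have h := (hasFDerivAt_actionAngle hp).comp_hasDerivAt p.2
    ((hasDerivAt_const p.2 p.1).prodMk (hasDerivAt_id p.2))
  rw [h.unique (hasDerivAt_actionAngle hp p.2)]
  exact mul_pos (angleFactor_pos hp) (ellipticIntegrand_pos hp _)

theorem contDiffOn_levelVelocity : ContDiffOn ℝ ∞ levelVelocity ellipticDomain := by
  have h := ((contDiffOn_infty_iff_fderiv_of_isOpen isOpen_ellipticDomain).1
    contDiffOn_actionAngle).2
  exact (h.clm_apply contDiffOn_const).neg.div (h.clm_apply contDiffOn_const)
    fun p hp => (fderiv_actionAngle_snd_pos hp).ne'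

theorem contDiffOn_levelDeriv (k : ℕ) : ContDiffOn ℝ ∞ (levelDeriv k) ellipticDomain := by
  induction k with
  | zero => exact contDiffOn_snd
  | succ k ih =>
    exact ((contDiffOn_infty_iff_fderiv_of_isOpen isOpen_ellipticDomain).1 ih).2.clm_apply
      (contDiffOn_const.prodMk contDiffOn_levelVelocity)

theorem hasDerivAt_of_actionAngle_eq {γ : ℝ → ℝ} {s θ : ℝ} (hs : |s| < 1)
    (hγ : DifferentiableAt ℝ γ s) (hinv : ∀ᶠ t in nhds s, actionAngle t (γ t) = θ) :
    HasDerivAt γ (levelVelocity (s, γ s)) s := by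
  have hp : (s, γ s) ∈ ellipticDomain := hs
  refine hγ.hasDerivAt.congr_deriv ?_
  have h := (hasFDerivAt_actionAngle hp).comp_hasDerivAt s
    ((hasDerivAt_id s).prodMk hγ.hasDerivAt)
  have h0 := h.unique ((hasDerivAt_const s θ).congr_of_eventuallyEq hinv)
  have hsplit : ((1 : ℝ), deriv γ s) = (1, 0) + deriv γ s • ((0 : ℝ), (1 : ℝ)) := by simp
  rw [hsplit, map_add, map_smul, smul_eq_mul] at h0
  rw [levelVelocity, eq_div_iff (fderiv_actionAngle_snd_pos hp).ne']
  linarith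

section LevelCurve

variable {ε θ : ℝ} {γ : ℝ → ℝ}

theorem iteratedDeriv_eq_levelDeriv (hε1 : ε < 1)
    (hγ : DifferentiableOn ℝ γ (Set.Ioo (-ε) ε))
    (hinv : ∀ s, |s| < ε → actionAngle s (γ s) = θ) (k : ℕ) :
    ∀ s, |s| < ε → iteratedDeriv k γ s = levelDeriv k (s, γ s) := by
  have hnhds : ∀ s, |s| < ε → ∀ᶠ t in nhds s, |t| < ε := fun s hs =>
    (isOpen_lt continuous_abs continuous_const).mem_nhds hs
  induction k with
  | zero => intro s _; simp [levelDeriv]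
  | succ k ih =>
    intro s hs
    have hp : (s, γ s) ∈ ellipticDomain := hs.trans hε1
    have hd : HasDerivAt γ (levelVelocity (s, γ s)) s :=
      hasDerivAt_of_actionAngle_eq (hs.trans hε1)
        (hγ.differentiableAt (Ioo_mem_nhds (abs_lt.1 hs).1 (abs_lt.1 hs).2))
        ((hnhds s hs).mono hinv)
    have hR : HasFDerivAt (levelDeriv k) (fderiv ℝ (levelDeriv k) (s, γ s)) (s, γ s) :=
      (((contDiffOn_levelDeriv k).contDiffAt (isOpen_ellipticDomain.mem_nhds hp)).differentiableAt
        (by simp)).hasFDerivAt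
    rw [iteratedDeriv_succ, Filter.EventuallyEq.deriv_eq ((hnhds s hs).mono ih)]
    exact (hR.comp_hasDerivAt s ((hasDerivAt_id s).prodMk hd)).deriv

theorem abs_sub_sum_levelDeriv_le {C : ℝ} (hε0 : 0 < ε) (hε1 : ε < 1)
    (hγ : ContDiffOn ℝ ∞ γ (Set.Ioo (-ε) ε))
    (hinv : ∀ s, |s| < ε → actionAngle s (γ s) = θ) (n : ℕ)
    (hC : ∀ t ∈ Set.Icc 0 (ε / 2), |levelDeriv (n + 1) (t, γ t)| ≤ C)
    {s : ℝ} (hs : s ∈ Set.Icc 0 (ε / 2)) :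
    |γ s - ∑ k ∈ Finset.range (n + 1), levelDeriv k (0, γ 0) / k.factorial * s ^ k|
      ≤ C * s ^ (n + 1) / n.factorial := by
  have hpos : 0 < ε / 2 := by positivity
  have hsub : Set.Icc 0 (ε / 2) ⊆ Set.Ioo (-ε) ε := fun t ht =>
    ⟨by linarith [ht.1], by linarith [ht.2]⟩
  have hder : ∀ k, ∀ t ∈ Set.Icc 0 (ε / 2),
      iteratedDerivWithin k γ (Set.Icc 0 (ε / 2)) t = levelDeriv k (t, γ t) := by
    intro k t ht
    have ht' := hsub ht
    rw [iteratedDerivWithin_eq_iteratedDeriv (uniqueDiffOn_Icc hpos)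
      ((hγ.contDiffAt (Ioo_mem_nhds ht'.1 ht'.2)).of_le (mod_cast le_top)) ht]
    exact iteratedDeriv_eq_levelDeriv hε1 (hγ.differentiableOn (by simp)) hinv k t (abs_lt.2 ht')
  have h := taylor_mean_remainder_bound (n := n) (C := C) hpos.le
    ((hγ.mono hsub).of_le (mod_cast le_top)) hs fun t ht => by
      rw [hder _ t ht]; exact hC t ht
  rw [taylor_within_apply, sub_zero, Real.norm_eq_abs] at h
  refine (le_of_eq ?_).trans h
  congr 2
  refine Finset.sum_congr rfl fun k _ => ?_
  rw [hder k 0 ⟨le_rfl, hpos.le⟩, smul_eq_mul]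
  ring

end LevelCurve

/-- The Fourier cosine integral of `cos (2 j θ)`, viewed as a function of the elliptic
coordinate. -/
noncomputable def phaseIntegral (j : ℕ) (s : ℝ) (m : ℕ) : ℝ :=
  ∫ x in (-π)..π, cos (2 * j * actionAngle s x) * cos (2 * m * x)

theorem phaseIntegral_recurrence {s : ℝ} (hs : |s| < 1) (j m : ℕ) :
    4 * (angleFactor s ^ 2 * j ^ 2 - m ^ 2 * (1 - s / 2)) * phaseIntegral j s m =
      s * ((if m = 0 then 0 else ((m : ℝ) - 1) * (m - 1 / 2)) * phaseIntegral j s (m - 1) +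
        (if m = 0 then 2 else 1) * (((m : ℝ) + 1) * (m + 1 / 2)) * phaseIntegral j s (m + 1)) := by
  have h := integral_cos_phase_recurrence j m (ellipticIntegrand_sq_mul hs)
    (hasDerivAt_ellipticIntegrand hs) (hasDerivAt_actionAngle hs) (actionAngle_pi hs)
    (by rw [actionAngle_neg, actionAngle_pi hs])
  unfold phaseIntegral
  rw [h]
  rcases m with _ | m
  · have e : ∀ x : ℝ, cos (2 * (-1) * x) = cos (2 * x) := fun x => by
      rw [← cos_neg]; ring_nf
    norm_num [e]
    exact Or.inl (by ring)
  · simp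

theorem integral_cos_sq_two_mul (j : ℕ) (hj : 1 ≤ j) :
    ∫ x in (-π)..π, cos (2 * j * x) * cos (2 * j * x) = π := by
  have hj0 : (j : ℝ) ≠ 0 := by positivity
  have hd : ∀ x : ℝ, HasDerivAt (fun x => x / 2 + sin (2 * ((2 * j : ℕ) : ℝ) * x) / (8 * j))
      (cos (2 * j * x) * cos (2 * j * x)) x := by
    intro x
    refine (((hasDerivAt_id x).div_const 2).add
      ((((hasDerivAt_id x).const_mul (2 * ((2 * j : ℕ) : ℝ))).sin).div_const (8 * j))).congr_deriv ?_
    have : cos (2 * ((2 * j : ℕ) : ℝ) * x) = 2 * cos (2 * j * x) ^ 2 - 1 := by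
      rw [← cos_two_mul]; push_cast; ring_nf
    simp only [id, this]
    push_cast
    field_simp
    ring
  have hsin : sin (2 * ((2 * j : ℕ) : ℝ) * π) = 0 := by
    rw [← Nat.cast_ofNat, ← Nat.cast_mul]; exact sin_nat_mul_pi _
  rw [integral_eq_sub_of_hasDerivAt (fun x _ => hd x)
    (Continuous.intervalIntegrable (by fun_prop) _ _)]
  simp only [mul_neg, sin_neg, hsin]
  ring

section Asymptotics

open Filter Topology Asymptotics

theorem eventually_abs_lt_nhdsGT {ε : ℝ} (hε : 0 < ε) : ∀ᶠ s in 𝓝[>] (0 : ℝ), |s| < ε :=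
  nhdsWithin_le_nhds
    ((isOpen_lt continuous_abs continuous_const).mem_nhds (by simpa using hε))

theorem tendsto_phaseIntegral_self (j : ℕ) (hj : 1 ≤ j) :
    Tendsto (fun s => phaseIntegral j s j) (𝓝[>] 0) (𝓝 π) := by
  rw [← integral_cos_sq_two_mul j hj]
  refine tendsto_integral_filter_of_dominated_convergence (fun _ => 1) ?_ ?_ ?_ ?_
  · filter_upwards [eventually_abs_lt_nhdsGT one_pos] with s hs
    have := continuous_actionAngle hs
    exact Continuous.aestronglyMeasurable (by fun_prop)
  · refine Eventually.of_forall fun s => Eventually.of_forall fun x _ => ?_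
    rw [norm_mul, Real.norm_eq_abs, Real.norm_eq_abs]
    exact mul_le_one₀ (abs_cos_le_one _) (abs_nonneg _) (abs_cos_le_one _)
  · exact intervalIntegrable_const
  · refine Eventually.of_forall fun x _ => ?_
    have h : ContinuousAt (fun p : ℝ × ℝ => actionAngle p.1 p.2) (0, x) :=
      contDiffOn_actionAngle.continuousOn.continuousAt
        (isOpen_ellipticDomain.mem_nhds (by simp [ellipticDomain]))
    have h' : ContinuousAt (fun s : ℝ => actionAngle s x) 0 :=
      ContinuousAt.comp (f := fun s : ℝ => (s, x)) h (by fun_prop)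
    have h'' : ContinuousAt (fun s : ℝ => cos (2 * j * actionAngle s x) * cos (2 * j * x)) 0 := by
      fun_prop
    have := h''.tendsto
    rw [actionAngle_zero_left] at this
    exact this.mono_left nhdsWithin_le_nhds

theorem tendsto_phaseIntegral_zero_div_pow (j : ℕ) (hj : 1 ≤ j) :
    Tendsto (fun s => phaseIntegral j s 0 / s ^ j) (𝓝[>] 0) (𝓝 (π * (4 / 16 ^ j))) := by
  rw [← prod_recurrence_ratio j hj]
  refine tendsto_div_pow_of_recurrence
    (D := fun s m => 4 * (angleFactor s ^ 2 * j ^ 2 - m ^ 2 * (1 - s / 2)))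
    (A := fun m => if m = 0 then 0 else ((m : ℝ) - 1) * (m - 1 / 2))
    (B := fun m => (if m = 0 then 2 else 1) * (((m : ℝ) + 1) * (m + 1 / 2)))
    (d := fun m => 4 * ((j : ℝ) ^ 2 - m ^ 2)) ?_ ?_ ?_ ?_ (tendsto_phaseIntegral_self j hj)
  · intro m
    refine IsBigO.of_bound (1 * |π - -π|) (Eventually.of_forall fun s => ?_)
    rw [Pi.one_apply, norm_one, mul_one]
    refine intervalIntegral.norm_integral_le_of_norm_le_const fun x _ => ?_
    rw [norm_mul, Real.norm_eq_abs, Real.norm_eq_abs]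
    exact mul_le_one₀ (abs_cos_le_one _) (abs_nonneg _) (abs_cos_le_one _)
  · intro m _
    have h := continuousAt_angleFactor_zero
    have h' : ContinuousAt
        (fun s : ℝ => 4 * (angleFactor s ^ 2 * j ^ 2 - m ^ 2 * (1 - s / 2))) 0 := by fun_prop
    have := h'.tendsto
    simp only [angleFactor_zero, one_pow, one_mul, zero_div, sub_zero, mul_one] at this
    exact this.mono_left nhdsWithin_le_nhds
  · intro m hm
    have hm' : (m : ℝ) < j := by exact_mod_cast hm
    have : (m : ℝ) ^ 2 < j ^ 2 := by gcongr
    exact ne_of_gt (by linarith)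
  · intro m _
    filter_upwards [eventually_abs_lt_nhdsGT one_pos] with s hs
    exact phaseIntegral_recurrence hs j m

end Asymptotics

theorem integral_inverse_mul_sin {s : ℝ} (hs : |s| < 1) {γ : ℝ → ℝ}
    (hinv : ∀ θ, actionAngle s (γ θ) = θ) (hγ : Continuous γ) (j : ℕ) (hj : 1 ≤ j) :
    ∫ θ in (-π)..π, γ θ * sin (2 * j * θ) = -(π / j) + phaseIntegral j s 0 / (2 * j) := by
  have hj0 : (j : ℝ) ≠ 0 := by positivity
  have hf := continuous_actionAngle hs
  have hr := continuous_ellipticIntegrand hs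
  have hleft : ∀ φ, γ (actionAngle s φ) = φ := fun φ =>
    (strictMono_actionAngle hs).injective (hinv _)
  have hπ := actionAngle_pi hs
  have hnπ : actionAngle s (-π) = -π := by rw [actionAngle_neg, hπ]
  have hcos : cos (2 * j * π) = 1 := by
    rw [mul_comm 2, mul_assoc]; exact cos_nat_mul_two_pi j
  have hsub := integral_comp_mul_deriv (a := -π) (b := π) (f := actionAngle s)
    (g := fun θ => γ θ * sin (2 * j * θ)) (fun x _ => hasDerivAt_actionAngle hs x)
    (by fun_prop) (by fun_prop)
  rw [hπ, hnπ] at hsub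
  rw [← hsub]
  have hparts := integral_eq_sub_of_hasDerivAt (a := -π) (b := π)
    (f := fun x => -(x * cos (2 * j * actionAngle s x)) / (2 * j))
    (f' := fun x => x * sin (2 * j * actionAngle s x) * (angleFactor s * ellipticIntegrand s x)
      - cos (2 * j * actionAngle s x) / (2 * j))
    (fun x _ => by
      refine ((((hasDerivAt_id x).mul
        (((hasDerivAt_actionAngle hs x).const_mul (2 * (j : ℝ))).cos)).neg).div_const
          (2 * (j : ℝ))).congr_deriv ?_
      simp only [id]
      field_simp
      ring)
    (Continuous.intervalIntegrable (by fun_prop) _ _)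
  rw [intervalIntegral.integral_sub (Continuous.intervalIntegrable (by fun_prop) _ _)
    (Continuous.intervalIntegrable (by fun_prop) _ _), intervalIntegral.integral_div,
    hπ, hnπ, mul_neg, cos_neg, hcos] at hparts
  simp only [phaseIntegral, Function.comp_apply, hleft, Nat.cast_zero, mul_zero, zero_mul, cos_zero,
    mul_one]
  rw [sub_eq_iff_eq_add.1 hparts]
  field_simp
  ring

section Inversion

open Filter Topology

variable {ε : ℝ} {g : ℝ → ℝ → ℝ}

theorem strictMono_of_actionAngle_eq {s : ℝ} (hs : |s| < 1) {γ : ℝ → ℝ}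
    (hinv : ∀ θ, actionAngle s (γ θ) = θ) : StrictMono γ := fun x y hxy => by
  rw [← (strictMono_actionAngle hs).lt_iff_lt, hinv, hinv]
  exact hxy

theorem continuous_of_actionAngle_eq {s : ℝ} (hs : |s| < 1) {γ : ℝ → ℝ}
    (hinv : ∀ θ, actionAngle s (γ θ) = θ) : Continuous γ :=
  (strictMono_of_actionAngle_eq hs hinv).monotone.continuous_of_surjective fun φ =>
    ⟨actionAngle s φ, (strictMono_actionAngle hs).injective (hinv _)⟩

theorem mem_Icc_of_actionAngle_eq {s φ θ : ℝ} (hs : |s| < 1) (h : actionAngle s φ = θ)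
    (hθ : θ ∈ Set.Icc (-π) π) : φ ∈ Set.Icc (-π) π := by
  rw [Set.mem_Icc, ← (strictMono_actionAngle hs).le_iff_le (a := -π),
    ← (strictMono_actionAngle hs).le_iff_le (a := φ), actionAngle_neg, actionAngle_pi hs, h]
  exact hθ

theorem continuous_levelDeriv_zero (k : ℕ) : Continuous fun θ : ℝ => levelDeriv k (0, θ) :=
  (contDiffOn_levelDeriv k).continuousOn.comp_continuous (by fun_prop)
    fun θ => by simp [ellipticDomain]

theorem exists_taylor_bound (hε0 : 0 < ε) (hε1 : ε < 1) (hg0 : ∀ θ : ℝ, g 0 θ = θ)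
    (hsmooth : ∀ θ : ℝ, ContDiffOn ℝ ∞ (fun s => g s θ) (Set.Ioo (-ε) ε))
    (hinv : ∀ θ : ℝ, ∀ s : ℝ, |s| < ε → actionAngle s (g s θ) = θ) (n : ℕ) :
    ∃ C, ∀ s ∈ Set.Icc 0 (ε / 2), ∀ θ ∈ Set.Icc (-π) π,
      |g s θ - ∑ k ∈ Finset.range (n + 1), levelDeriv k (0, θ) / k.factorial * s ^ k|
        ≤ C * s ^ (n + 1) := by
  have habs : ∀ t ∈ Set.Icc 0 (ε / 2), |t| < ε := fun t ht => by
    rw [abs_of_nonneg ht.1]; linarith [ht.2]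
  obtain ⟨C, hC⟩ := ((isCompact_Icc (a := 0) (b := ε / 2)).prod
    (isCompact_Icc (a := -π) (b := π))).bddAbove_image (f := fun p => |levelDeriv (n + 1) p|)
    ((contDiffOn_levelDeriv (n + 1)).continuousOn.mono fun p hp =>
      (habs p.1 hp.1).trans hε1).abs
  refine ⟨C / n.factorial, fun s hs θ hθ => ?_⟩
  have h := abs_sub_sum_levelDeriv_le hε0 hε1 (hsmooth θ) (hinv θ) n (C := C)
    (fun t ht => hC ⟨(t, g t θ), ⟨ht, mem_Icc_of_actionAngle_eq ((habs t ht).trans hε1)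
      (hinv θ t (habs t ht)) hθ⟩, rfl⟩) hs
  rw [hg0] at h
  rwa [div_mul_eq_mul_div]

theorem tendsto_sum_fourier_div_pow (hε0 : 0 < ε) (hε1 : ε < 1) (hg0 : ∀ θ : ℝ, g 0 θ = θ)
    (hsmooth : ∀ θ : ℝ, ContDiffOn ℝ ∞ (fun s => g s θ) (Set.Ioo (-ε) ε))
    (hinv : ∀ θ : ℝ, ∀ s : ℝ, |s| < ε → actionAngle s (g s θ) = θ) (j : ℕ) (hj : 1 ≤ j) :
    Tendsto (fun s : ℝ => (∑ k ∈ Finset.range (j + 1),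
      ((∫ θ in (-π)..π, levelDeriv k (0, θ) * sin (2 * j * θ)) / k.factorial
        + if k = 0 then π / j else 0) * s ^ k) / s ^ j) (𝓝[>] 0)
      (𝓝 (π * (4 / 16 ^ j) / (2 * j))) := by
  obtain ⟨C, hC⟩ := exists_taylor_bound hε0 hε1 hg0 hsmooth hinv j
  have hrem : Tendsto (fun s : ℝ => C * s * |π - -π|) (𝓝[>] 0) (𝓝 0) :=
    (Continuous.tendsto' (by fun_prop) _ _ (by simp)).mono_left nhdsWithin_le_nhds
  refine ((tendsto_phaseIntegral_zero_div_pow j hj).div_const (2 * (j : ℝ))).congr_dist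
    (squeeze_zero' (Eventually.of_forall fun _ => dist_nonneg) ?_ hrem)
  filter_upwards [eventually_abs_lt_nhdsGT (half_pos hε0), self_mem_nhdsWithin] with s hs hpos
  have hpos : 0 < s := hpos
  have hsε : |s| < ε := by linarith
  have hs1 : |s| < 1 := hsε.trans hε1
  have hsI : s ∈ Set.Icc 0 (ε / 2) := ⟨hpos.le, (le_abs_self s).trans hs.le⟩
  have hgc : Continuous (g s) := continuous_of_actionAngle_eq hs1 fun θ => hinv θ s hsε
  have hlc := continuous_levelDeriv_zero
  have hG := integral_inverse_mul_sin hs1 (fun θ => hinv θ s hsε) hgc j hj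
  have hsum : ∑ k ∈ Finset.range (j + 1),
      ((∫ θ in (-π)..π, levelDeriv k (0, θ) * sin (2 * j * θ)) / k.factorial
        + if k = 0 then π / j else 0) * s ^ k =
      (∫ θ in (-π)..π, (∑ k ∈ Finset.range (j + 1),
        levelDeriv k (0, θ) / k.factorial * s ^ k) * sin (2 * j * θ)) + π / j := by
    simp only [Finset.sum_mul, add_mul, Finset.sum_add_distrib]
    rw [intervalIntegral.integral_finsetSum fun k _ =>
      Continuous.intervalIntegrable (by have := hlc k; fun_prop) _ _]
    congr 1
    · refine Finset.sum_congr rfl fun k _ => ?_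
      rw [← intervalIntegral.integral_div, ← intervalIntegral.integral_mul_const]
      congr 1
      ext θ
      ring
    · simp
  have hphase : phaseIntegral j s 0 / (2 * j)
      = (∫ θ in (-π)..π, g s θ * sin (2 * j * θ)) + π / j := by
    rw [hG]; ring
  have hbound : |(∫ θ in (-π)..π, g s θ * sin (2 * j * θ)) -
      ∫ θ in (-π)..π, (∑ k ∈ Finset.range (j + 1),
        levelDeriv k (0, θ) / k.factorial * s ^ k) * sin (2 * j * θ)|
      ≤ C * s ^ (j + 1) * |π - -π| := by
    rw [← intervalIntegral.integral_sub (Continuous.intervalIntegrable (by fun_prop) _ _)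
      (Continuous.intervalIntegrable (by fun_prop) _ _), ← Real.norm_eq_abs (∫ _ in _.._, _)]
    refine intervalIntegral.norm_integral_le_of_norm_le_const fun θ hθ => ?_
    rw [Set.uIoc_of_le (by linarith [pi_pos])] at hθ
    rw [← sub_mul, norm_mul, Real.norm_eq_abs, Real.norm_eq_abs]
    exact (mul_le_of_le_one_right (abs_nonneg _) (abs_sin_le_one _)).trans
      (hC s hsI θ ⟨hθ.1.le, hθ.2⟩)
  rw [hsum, div_right_comm, hphase, Real.dist_eq, ← sub_div, add_sub_add_right_eq_sub, abs_div,
    abs_of_pos (pow_pos hpos j), div_le_iff₀ (pow_pos hpos j)]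
  refine hbound.trans (le_of_eq ?_)
  ring

end Inversion

theorem beta_diag (ε : ℝ) (hε0 : 0 < ε) (hε1 : ε < 1) (g : ℝ → ℝ → ℝ)
    (hg0 : ∀ θ : ℝ, g 0 θ = θ)
    (hsmooth : ∀ θ : ℝ, ContDiffOn ℝ ∞ (fun s => g s θ) (Set.Ioo (-ε) ε))
    (hinv : ∀ θ : ℝ, ∀ s : ℝ, |s| < ε → actionAngle s (g s θ) = θ)
    (j : ℕ) (hj : 1 ≤ j) :
    (1 / (π * (Nat.factorial j : ℝ))) *
      ∫ θ in (-π)..π, iteratedDeriv j (fun s => g s θ) 0 * Real.sin (2 * j * θ)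
      = 2 / ((2:ℝ) ^ (4 * j) * j) := by
  have hj0 : (j : ℝ) ≠ 0 := by positivity
  have h := eq_of_tendsto_sum_pow_div j _ _
    (tendsto_sum_fourier_div_pow hε0 hε1 hg0 hsmooth hinv j hj)
  have hder : ∀ θ, iteratedDeriv j (fun s => g s θ) 0 = levelDeriv j (0, θ) := fun θ => by
    rw [iteratedDeriv_eq_levelDeriv hε1 ((hsmooth θ).differentiableOn (by simp)) (hinv θ) j 0
      (by simpa using hε0), hg0]
  simp only [hder]
  rw [if_neg (by omega), add_zero, div_eq_iff (by positivity)] at h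
  rw [h, pow_mul]
  have := Nat.factorial_ne_zero j
  norm_num
  field_simp
  norm_num
end

section
/- Let q ≥ 5 be a prime, let W be the least common multiple of the integers 1, 2, …, q−1, let w = exp(2πi/W) ∈ ℂ, and let F = ℚ(w) be the subfield of ℂ generated by w over ℚ. Then for every integer p with 1 ≤ p ≤ q−1, the minimal polynomial of cos(2πp/q) (viewed as an element of ℂ) over F has degree (q−1)/2; in particular it coincides with the minimal polynomial of cos(2πp/q) over ℚ. -/
open Real Complex

open IntermediateField in
theorem IsPrimitiveRoot.finrank_adjoin_rat {μ : ℂ} {n : ℕ} (h : IsPrimitiveRoot μ n)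
    (hn : 0 < n) : Module.finrank ℚ ℚ⟮μ⟯ = n.totient := by
  rw [adjoin.finrank ((h.isIntegral hn).tower_top), ← Polynomial.cyclotomic_eq_minpoly_rat h hn,
    Polynomial.natDegree_cyclotomic]

open IntermediateField in
/-- Adjoining a primitive root of unity of order `n` to a cyclotomic field of order `m` coprime
to `n` gives an extension of degree at least `φ n`. -/
theorem IsPrimitiveRoot.totient_le_natDegree_minpoly {w ζ : ℂ} {m n : ℕ}
    (hw : IsPrimitiveRoot w m) (hζ : IsPrimitiveRoot ζ n) (hm : 0 < m) (hn : 0 < n)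
    (hmn : m.Coprime n) : n.totient ≤ (minpoly ℚ⟮w⟯ ζ).natDegree := by
  have hζi : IsIntegral ℚ⟮w⟯ ζ := (hζ.isIntegral hn).tower_top
  have hprim : IsPrimitiveRoot (w * ζ) (m * n) := by
    have h := IsPrimitiveRoot.orderOf (w * ζ)
    rwa [(Commute.all w ζ).orderOf_mul_eq_mul_orderOf_of_coprime
      (by rwa [← hw.eq_orderOf, ← hζ.eq_orderOf]), ← hw.eq_orderOf, ← hζ.eq_orderOf] at h
  have hwi : IsIntegral ℚ w := (hw.isIntegral hm).tower_top
  have : FiniteDimensional ℚ ℚ⟮w⟯ := adjoin.finiteDimensional hwi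
  have : FiniteDimensional ℚ⟮w⟯ (ℚ⟮w⟯⟮ζ⟯) := adjoin.finiteDimensional hζi
  have : FiniteDimensional ℚ (ℚ⟮w⟯⟮ζ⟯) := FiniteDimensional.trans ℚ ℚ⟮w⟯ _
  have : FiniteDimensional ℚ ((ℚ⟮w⟯⟮ζ⟯).restrictScalars ℚ) := this
  have hle : ℚ⟮w * ζ⟯ ≤ (ℚ⟮w⟯⟮ζ⟯).restrictScalars ℚ := by
    rw [adjoin_simple_le_iff, mem_restrictScalars]
    exact mul_mem ((ℚ⟮w⟯⟮ζ⟯).algebraMap_mem ⟨w, mem_adjoin_simple_self ℚ w⟩)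
      (mem_adjoin_simple_self _ ζ)
  have h1 : Module.finrank ℚ ℚ⟮w * ζ⟯ ≤ Module.finrank ℚ (ℚ⟮w⟯⟮ζ⟯) := finrank_le_of_le_right hle
  rw [← Module.finrank_mul_finrank ℚ ℚ⟮w⟯ (ℚ⟮w⟯⟮ζ⟯), hprim.finrank_adjoin_rat (by positivity),
    hw.finrank_adjoin_rat hm, adjoin.finrank hζi, Nat.totient_mul hmn] at h1
  exact Nat.le_of_mul_le_mul_left h1 (Nat.totient_pos.2 hm)

theorem minpoly.natDegree_le_two_of_sq_add_one {K L : Type*} [Field K] [Field L] [Algebra K L]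
    {γ : K} {ζ : L} (h : ζ ^ 2 + 1 = 2 * algebraMap K L γ * ζ) :
    IsIntegral K ζ ∧ (minpoly K ζ).natDegree ≤ 2 := by
  have hP : (Polynomial.X ^ 2 + (Polynomial.C (-(2 * γ)) * Polynomial.X + Polynomial.C 1)).Monic :=
    Polynomial.monic_X_pow_add (n := 2) Polynomial.degree_linear_lt
  have hPz : Polynomial.aeval ζ
      (Polynomial.X ^ 2 + (Polynomial.C (-(2 * γ)) * Polynomial.X + Polynomial.C 1)) = 0 := by
    simp only [map_add, map_mul, map_pow, Polynomial.aeval_X, Polynomial.aeval_C, map_neg,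
      map_one, map_ofNat]
    linear_combination h
  refine ⟨⟨_, hP, hPz⟩, (Polynomial.natDegree_le_of_dvd (minpoly.dvd _ _ hPz) hP.ne_zero).trans ?_⟩
  compute_degree

open IntermediateField in
theorem minpoly.natDegree_le_finrank_mul_natDegree {K E L : Type*} [Field K] [Field E] [Field L]
    [Algebra K E] [Algebra E L] [Algebra K L] [IsScalarTower K E L] [FiniteDimensional K E]
    {ζ : L} (hζ : IsIntegral E ζ) :
    (minpoly K ζ).natDegree ≤ Module.finrank K E * (minpoly E ζ).natDegree := by
  have : FiniteDimensional E E⟮ζ⟯ := adjoin.finiteDimensional hζ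
  have : FiniteDimensional K E⟮ζ⟯ := FiniteDimensional.trans K E _
  have : FiniteDimensional K (E⟮ζ⟯.restrictScalars K) := this
  have hle : K⟮ζ⟯ ≤ E⟮ζ⟯.restrictScalars K := by
    rw [adjoin_simple_le_iff, mem_restrictScalars]
    exact mem_adjoin_simple_self _ ζ
  have h : Module.finrank K K⟮ζ⟯ ≤ Module.finrank K E⟮ζ⟯ := finrank_le_of_le_right hle
  rwa [← Module.finrank_mul_finrank K E E⟮ζ⟯, adjoin.finrank hζ,
    adjoin.finrank (isIntegral_trans (A := E) ζ hζ)] at h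

open IntermediateField in
theorem minpoly.natDegree_le_two_mul_of_sq_add_one {K L : Type*} [Field K] [Field L] [Algebra K L]
    {c ζ : L} (hc : IsIntegral K c) (h : ζ ^ 2 + 1 = 2 * c * ζ) :
    (minpoly K ζ).natDegree ≤ 2 * (minpoly K c).natDegree := by
  obtain ⟨hζ, hdeg⟩ := minpoly.natDegree_le_two_of_sq_add_one (K := K⟮c⟯)
    (γ := AdjoinSimple.gen K c) (by rwa [AdjoinSimple.algebraMap_gen])
  have : FiniteDimensional K K⟮c⟯ := adjoin.finiteDimensional hc
  rw [mul_comm, ← adjoin.finrank hc]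
  exact (minpoly.natDegree_le_finrank_mul_natDegree hζ).trans (Nat.mul_le_mul_left _ hdeg)

open IntermediateField in
/-- The degree of a real element of `ℚ(ζ)` is at most half of the degree of a nonreal `ζ`. -/
theorem two_mul_natDegree_minpoly_ofReal_le {ζ : ℂ} {c : ℝ} (hζ : IsIntegral ℚ ζ)
    (hc : (c : ℂ) ∈ ℚ⟮ζ⟯) (him : ζ.im ≠ 0) :
    2 * (minpoly ℚ (c : ℂ)).natDegree ≤ (minpoly ℚ ζ).natDegree := by
  have : FiniteDimensional ℚ ℚ⟮ζ⟯ := adjoin.finiteDimensional hζ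
  have hle : ℚ⟮(c : ℂ)⟯ ≤ ℚ⟮ζ⟯ := adjoin_simple_le_iff.2 hc
  have hci : IsIntegral ℚ (c : ℂ) :=
    IntermediateField.isIntegral_iff.1
      (IsIntegral.of_finite ℚ (⟨(c : ℂ), hc⟩ : ℚ⟮ζ⟯))
  have hne : Module.finrank ℚ ℚ⟮(c : ℂ)⟯ ≠ Module.finrank ℚ ℚ⟮ζ⟯ := fun h => by
    have hmem : ζ ∈ ℚ⟮(c : ℂ)⟯ := eq_of_le_of_finrank_eq hle h ▸ mem_adjoin_simple_self ℚ ζ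
    have hreal : ℚ⟮(c : ℂ)⟯ ≤ (Complex.ofRealAm.restrictScalars ℚ).fieldRange :=
      adjoin_simple_le_iff.2 ⟨c, rfl⟩
    obtain ⟨x, rfl⟩ := hreal hmem
    exact him (Complex.ofReal_im x)
  have hdvd : Module.finrank ℚ ℚ⟮(c : ℂ)⟯ ∣ Module.finrank ℚ ℚ⟮ζ⟯ := finrank_dvd_of_le_right hle
  have hpos : 0 < Module.finrank ℚ ℚ⟮ζ⟯ := Module.finrank_pos
  rw [← adjoin.finrank hci, ← adjoin.finrank hζ]
  obtain ⟨k, hk⟩ := hdvd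
  have hk2 : 2 ≤ k := by
    by_contra! hlt
    interval_cases k <;> omega
  rw [hk, mul_comm]
  exact Nat.mul_le_mul_left _ hk2

theorem Nat.Prime.coprime_lcm_Icc {q : ℕ} (hq : q.Prime) :
    ((Finset.Icc 1 (q - 1)).lcm id).Coprime q := by
  refine ((hq.coprime_iff_not_dvd).2 fun h => ?_).symm
  have hfac : (Finset.Icc 1 (q - 1)).lcm id ∣ (q - 1).factorial :=
    Finset.lcm_dvd fun b hb =>
      Nat.dvd_factorial (Finset.mem_Icc.1 hb).1 (Finset.mem_Icc.1 hb).2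
  have := (hq.dvd_factorial).1 (h.trans hfac)
  have := hq.pos
  omega

open IntermediateField in
theorem minpoly_cos_over_cyclotomic_field (q : ℕ) (hq : q.Prime) (hq5 : 5 ≤ q)
    (W : ℕ) (hW : W = (Finset.Icc 1 (q - 1)).lcm id)
    (w : ℂ) (hw : w = Complex.exp (2 * Real.pi * Complex.I / W))
    (F : IntermediateField ℚ ℂ) (hF : F = IntermediateField.adjoin ℚ {w})
    (p : ℕ) (hp1 : 1 ≤ p) (hpq : p ≤ q - 1) :
    (minpoly F ((Real.cos (2 * Real.pi * p / q) : ℝ) : ℂ)).natDegree = (q - 1) / 2 ∧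
    minpoly F ((Real.cos (2 * Real.pi * p / q) : ℝ) : ℂ)
      = (minpoly ℚ ((Real.cos (2 * Real.pi * p / q) : ℝ) : ℂ)).map (algebraMap ℚ F) := by
  have hWq : W.Coprime q := hW ▸ hq.coprime_lcm_Icc
  have hW0 : W ≠ 0 := by
    rintro rfl
    have := (Nat.coprime_zero_left q).1 hWq
    omega
  have hwprim : IsPrimitiveRoot w W := hw ▸ Complex.isPrimitiveRoot_exp W hW0
  subst hF
  set c : ℝ := Real.cos (2 * Real.pi * p / q) with hc
  obtain ⟨ζ, hζ⟩ : ∃ ζ : ℂ, ζ = Complex.exp (2 * Real.pi * Complex.I * (p / q)) := ⟨_, rfl⟩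
  have hζprim : IsPrimitiveRoot ζ q :=
    hζ ▸ Complex.isPrimitiveRoot_exp_of_coprime p q hq.ne_zero
      (Nat.coprime_of_lt_prime (by omega) (by omega) hq).symm
  have hζ0 : ζ ≠ 0 := hζprim.ne_zero hq.ne_zero
  have hcζ : (2 : ℂ) * c = ζ + ζ⁻¹ := by
    rw [hc, Complex.ofReal_cos, Complex.two_cos, hζ, ← Complex.exp_neg]
    push_cast
    ring_nf
  have hquad : ζ ^ 2 + 1 = 2 * c * ζ := by
    rw [hcζ]
    field_simp
  have hζi : IsIntegral ℚ ζ := (hζprim.isIntegral hq.pos).tower_top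
  have hcmem : (c : ℂ) ∈ ℚ⟮ζ⟯ := by
    have h2 : (c : ℂ) = (ζ + ζ⁻¹) / 2 := by rw [← hcζ]; ring
    have hmem := mem_adjoin_simple_self ℚ ζ
    exact h2 ▸ div_mem (add_mem hmem (inv_mem hmem)) (ofNat_mem _ 2)
  have him : ζ.im ≠ 0 := fun h => by
    have hre : ((ζ.re : ℝ) : ℂ) = ζ := Complex.ext rfl h.symm
    have hpow : ζ.re ^ q = 1 := by
      exact_mod_cast hre.symm ▸ hζprim.pow_eq_one
    have hone : ζ.re = 1 :=
      (hq.odd_of_ne_two (by omega)).pow_injective (hpow.trans (one_pow q).symm)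
    have hζ1 : ζ = 1 := by rw [← hre, hone, Complex.ofReal_one]
    exact hζprim.ne_one hq.one_lt hζ1
  have hfd : FiniteDimensional ℚ ℚ⟮ζ⟯ := adjoin.finiteDimensional hζi
  have hci : IsIntegral ℚ (c : ℂ) :=
    IntermediateField.isIntegral_iff.1
      (IsIntegral.of_finite ℚ (⟨(c : ℂ), hcmem⟩ : ℚ⟮ζ⟯))
  have hub := two_mul_natDegree_minpoly_ofReal_le hζi hcmem him
  rw [← adjoin.finrank hζi, hζprim.finrank_adjoin_rat hq.pos, Nat.totient_prime hq] at hub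
  have hlb := hwprim.totient_le_natDegree_minpoly hζprim (Nat.pos_of_ne_zero hW0) hq.pos hWq
  rw [Nat.totient_prime hq] at hlb
  have hlb' := minpoly.natDegree_le_two_mul_of_sq_add_one (K := ℚ⟮w⟯) hci.tower_top hquad
  have hdvd := minpoly.dvd_map_of_isScalarTower ℚ ℚ⟮w⟯ (c : ℂ)
  have hmonic := (minpoly.monic hci).map (algebraMap ℚ ℚ⟮w⟯)
  have hdeg := Polynomial.natDegree_le_of_dvd hdvd hmonic.ne_zero
  rw [Polynomial.natDegree_map] at hdeg
  refine ⟨by omega, (Polynomial.eq_of_monic_of_dvd_of_natDegree_le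
    (minpoly.monic hci.tower_top) hmonic hdvd ?_).symm⟩
  rw [Polynomial.natDegree_map]
  omega
end

section
/- Let q₀ ≥ 3 be an integer and let q be a prime with q ≥ 2q₀ such that every prime divisor of (q−1)/2 is at least q₀. Then the smallest subgroup of the unit group (ℤ/qℤ)* containing the residues of 1, 2, …, ⌊q/q₀⌋ and closed under negation (x ↦ −x) is all of (ℤ/qℤ)*; that is, q is q₀-A-good. -/
/-- A subgroup of `(ZMod q)ˣ` containing the classes of all `n` in a finite set `s` of
naturals below `q` has at least `s.card` elements. -/
theorem card_le_card_subgroup_of_forall_cast_mem {q : ℕ} [NeZero q] (H : Subgroup (ZMod q)ˣ)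
    (s : Finset ℕ) (hlt : ∀ n ∈ s, n < q)
    (hmem : ∀ n ∈ s, ∃ u ∈ H, (u : ZMod q) = (n : ZMod q)) :
    s.card ≤ Nat.card H := by
  choose! f hfH hf using hmem
  rw [← Nat.card_eq_finsetCard s]
  refine Nat.card_le_card_of_injective
    (fun n : s => (⟨f n, hfH n n.2⟩ : H)) fun a b hab => ?_
  have h : ((a : ℕ) : ZMod q) = ((b : ℕ) : ZMod q) := by
    rw [← hf a a.2, ← hf b b.2, Subtype.mk.inj hab]
  rw [ZMod.natCast_eq_natCast_iff'] at h
  rw [Nat.mod_eq_of_lt (hlt a a.2), Nat.mod_eq_of_lt (hlt b b.2)] at h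
  exact Subtype.ext h

/-- The index of a subgroup of `(ZMod q)ˣ` containing `-1` divides `(q - 1) / 2`. -/
theorem index_dvd_half_of_neg_one_mem {q : ℕ} (hq : q.Prime) (hq2 : 2 < q)
    (H : Subgroup (ZMod q)ˣ) (h : -1 ∈ H) : H.index ∣ (q - 1) / 2 := by
  have : Fact q.Prime := ⟨hq⟩
  have : Fact (2 < q) := ⟨hq2⟩
  have hcard : Nat.card H * H.index = q - 1 := by
    rw [H.card_mul_index, Nat.card_eq_fintype_card, ZMod.card_units]
  have hord : orderOf (⟨-1, h⟩ : H) = 2 := by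
    refine orderOf_eq_prime (Subtype.ext (by simp)) fun h1 => ?_
    have h2 : (-1 : (ZMod q)ˣ) = 1 := congrArg Subtype.val h1
    exact ZMod.neg_one_ne_one (by simpa using congrArg Units.val h2)
  obtain ⟨k, hk⟩ : 2 ∣ Nat.card H := hord ▸ orderOf_dvd_natCard _
  refine ⟨k, ?_⟩
  rw [← hcard, hk, mul_assoc, Nat.mul_div_cancel_left _ two_pos, mul_comm]

theorem q0_A_good_of_no_small_prime_divisor (q₀ q : ℕ) (hq₀ : 3 ≤ q₀) (hq : q.Prime)
    (hqq : 2 * q₀ ≤ q)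
    (hdiv : ∀ r : ℕ, r.Prime → r ∣ (q - 1) / 2 → q₀ ≤ r)
    (H : Subgroup (ZMod q)ˣ) (hneg : ∀ x ∈ H, -x ∈ H)
    (hcont : ∀ u : (ZMod q)ˣ,
      (∃ n : ℕ, 1 ≤ n ∧ n ≤ q / q₀ ∧ (u : ZMod q) = (n : ZMod q)) → u ∈ H) :
    H = ⊤ := by
  have : Fact q.Prime := ⟨hq⟩
  by_contra hH
  have hindex : q₀ ≤ H.index := by
    have hne : H.index ≠ 1 := fun h => hH (Subgroup.index_eq_one.mp h)
    exact (hdiv _ (Nat.minFac_prime hne) ((Nat.minFac_dvd _).trans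
      (index_dvd_half_of_neg_one_mem hq (by omega) H (hneg 1 H.one_mem)))).trans
      (Nat.minFac_le H.index_ne_zero_of_finite.bot_lt)
  have hcard : Nat.card H * H.index = q - 1 := by
    rw [H.card_mul_index, Nat.card_eq_fintype_card, ZMod.card_units]
  have hupper : Nat.card H ≤ q / q₀ := by
    rw [Nat.le_div_iff_mul_le (by omega)]
    exact (Nat.mul_le_mul_left _ hindex).trans (by omega)
  have hm : q / q₀ < q - 1 := by
    have : q / q₀ ≤ q / 3 := Nat.div_le_div_left hq₀ (by norm_num)
    omega
  have hlower := card_le_card_subgroup_of_forall_cast_mem H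
    (insert (q - 1) (Finset.Icc 1 (q / q₀)))
    (by
      simp only [Finset.mem_insert, Finset.mem_Icc]
      omega)
    (by
      intro n hn
      rcases Finset.mem_insert.mp hn with rfl | hn
      · exact ⟨-1, hneg 1 H.one_mem, by simp [Nat.cast_sub hq.one_le]⟩
      · obtain ⟨h1, h2⟩ := Finset.mem_Icc.mp hn
        have hn0 : (n : ZMod q) ≠ 0 := fun h =>
          absurd (Nat.le_of_dvd h1 ((ZMod.natCast_eq_zero_iff _ _).mp h)) (by omega)
        exact ⟨Units.mk0 _ hn0, hcont _ ⟨n, h1, h2, rfl⟩, rfl⟩)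
  rw [Finset.card_insert_of_notMem (by simp only [Finset.mem_Icc]; omega), Nat.card_Icc] at hlower
  omega
end

section
/- For every integer q₀ ≥ 3 there exist infinitely many primes q that are simultaneously q₀-A-good and q₀-B-good. -/
/-- A prime `q` is `q₀`-A-good if the minimal subgroup of `(ℤ/qℤ)*` that is symmetric
under negation and contains the residues of `1, 2, …, ⌊q/q₀⌋` is the whole unit group:
equivalently, every negation-closed subgroup containing those residues is `⊤`. -/
def IsAGood (q₀ q : ℕ) : Prop :=
  ∀ H : Subgroup (ZMod q)ˣ, (∀ x ∈ H, -x ∈ H) →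
    (∀ u : (ZMod q)ˣ,
      (∃ n : ℕ, 1 ≤ n ∧ n ≤ q / q₀ ∧ (u : ZMod q) = (n : ZMod q)) → u ∈ H) →
    H = ⊤

/-- A prime `q` is `q₀`-B-good if the minimal subgroup of `(ℤ/qℤ)*` that is symmetric
under negation and contains the residues of the odd numbers `1, 3, …, 2⌊q/q₀⌋ − 1`
is the whole unit group. -/
def IsBGood (q₀ q : ℕ) : Prop :=
  ∀ H : Subgroup (ZMod q)ˣ, (∀ x ∈ H, -x ∈ H) →
    (∀ u : (ZMod q)ˣ,
      (∃ n : ℕ, 1 ≤ n ∧ n ≤ q / q₀ ∧ (u : ZMod q) = ((2 * n - 1 : ℕ) : ZMod q)) → u ∈ H) →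
    H = ⊤

/-- A subgroup of `(ℤ/qℤ)ˣ` containing `-1` and the residues of `k` distinct integers in
`[1, q - 2]` has more than `k` elements. -/
lemma lt_card_of_neg_one_mem {q k : ℕ} (hq : q.Prime) (H : Subgroup (ZMod q)ˣ) (h1 : -1 ∈ H)
    (g : ℕ → ℕ) (hg : Set.InjOn g (Finset.Icc 1 k)) (hpos : ∀ n ∈ Finset.Icc 1 k, 1 ≤ g n)
    (hlt : ∀ n ∈ Finset.Icc 1 k, g n + 1 < q)
    (hH : ∀ u : (ZMod q)ˣ, (∃ n : ℕ, 1 ≤ n ∧ n ≤ k ∧ (u : ZMod q) = (g n : ZMod q)) → u ∈ H) :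
    k < Nat.card H := by
  have : Fact q.Prime := ⟨hq⟩
  classical
  set S : Finset ℕ := insert (q - 1) ((Finset.Icc 1 k).image g) with hS
  have hcard : S.card = k + 1 := by
    rw [hS, Finset.card_insert_of_notMem, Finset.card_image_of_injOn hg, Nat.card_Icc]
    · simp
    · intro hmem
      obtain ⟨n, hn, hn'⟩ := Finset.mem_image.1 hmem
      have := hlt n hn
      omega
  set T : Finset (ZMod q) := (Finset.univ.filter (· ∈ H)).image Units.val
  have hST : S.image (Nat.cast : ℕ → ZMod q) ⊆ T := by
    intro x hx
    obtain ⟨m, hm, rfl⟩ := Finset.mem_image.1 hx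
    rcases Finset.mem_insert.1 hm with rfl | hm
    · refine Finset.mem_image.2 ⟨-1, by simpa using h1, ?_⟩
      rw [Nat.cast_sub hq.one_lt.le]
      simp
    · obtain ⟨n, hn, rfl⟩ := Finset.mem_image.1 hm
      have hne : (g n : ZMod q) ≠ 0 := by
        rw [Ne, ZMod.natCast_eq_zero_iff]
        intro hd
        have := Nat.le_of_dvd (hpos n hn) hd
        have := hlt n hn
        omega
      refine Finset.mem_image.2 ⟨Units.mk0 _ hne, ?_, rfl⟩
      simp only [Finset.mem_filter, Finset.mem_univ, true_and]
      exact hH _ ⟨n, (Finset.mem_Icc.1 hn).1, (Finset.mem_Icc.1 hn).2, rfl⟩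
  have hinj : Set.InjOn (Nat.cast : ℕ → ZMod q) S := by
    have hSlt : ∀ m ∈ S, m < q := by
      intro m hm
      rcases Finset.mem_insert.1 hm with rfl | hm
      · exact Nat.sub_lt hq.pos one_pos
      · obtain ⟨n, hn, rfl⟩ := Finset.mem_image.1 hm
        have := hlt n hn
        omega
    intro a ha b hb hab
    rw [ZMod.natCast_eq_natCast_iff] at hab
    exact Nat.ModEq.eq_of_lt_of_lt hab (hSlt a ha) (hSlt b hb)
  have hle := Finset.card_le_card hST
  rw [Finset.card_image_of_injOn hinj, hcard,
    Finset.card_image_of_injective _ Units.val_injective] at hle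
  rw [Nat.card_eq_fintype_card, Fintype.card_subtype]
  exact hle

/-- If `q ≡ 3 (mod 4)` and `q - 1` has no odd prime factor below `q₀`, then a subgroup of
`(ℤ/qℤ)ˣ` containing `-1` and having more than `q / q₀` elements is everything. -/
lemma eq_top_of_div_lt_card {q₀ q : ℕ} (hq₀ : 0 < q₀) (hq : q.Prime) (h4 : q % 4 = 3)
    (hr : ∀ p : ℕ, p.Prime → p ≠ 2 → p < q₀ → ¬ p ∣ q - 1)
    (H : Subgroup (ZMod q)ˣ) (h1 : -1 ∈ H) (hcard : q / q₀ < Nat.card H) : H = ⊤ := by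
  have : Fact q.Prime := ⟨hq⟩
  have hmul : Nat.card H * H.index = q - 1 := by
    rw [Subgroup.card_mul_index, Nat.card_eq_fintype_card, ZMod.card_units]
  have heven : 2 ∣ Nat.card H := by
    have hord : orderOf (-1 : (ZMod q)ˣ) = 2 := by
      refine orderOf_eq_prime (by simp) fun h => ?_
      have h' : (-1 : ZMod q) = 1 := by simpa using congrArg Units.val h
      have : Fact (2 < q) := ⟨by omega⟩
      exact ZMod.neg_one_ne_one h'
    rw [← hord]
    exact Subgroup.orderOf_dvd_natCard H h1
  rw [← Subgroup.index_eq_one]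
  by_contra hne
  have hp := Nat.minFac_prime hne
  have hpd := Nat.minFac_dvd H.index
  have hpq : H.index.minFac ∣ q - 1 := hpd.trans ⟨_, by rw [mul_comm, hmul]⟩
  have hq₀p : q₀ ≤ H.index.minFac := by
    by_contra! hlt
    refine hr _ hp (fun h2 => ?_) hlt hpq
    have : 2 * 2 ∣ q - 1 := hmul ▸ mul_dvd_mul heven (h2 ▸ hpd)
    omega
  have hle : q₀ ≤ H.index := hq₀p.trans (Nat.minFac_le (by
    rcases Nat.eq_zero_or_pos H.index with h | h
    · rw [h] at hmul; omega
    · exact h))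
  have hlt : q < Nat.card H * q₀ := (Nat.div_lt_iff_lt_mul hq₀).1 hcard
  have := Nat.mul_le_mul_left (Nat.card H) hle
  omega

/-- There are arbitrarily large primes `q ≡ 3 (mod 4)` such that `q - 1` has no odd prime factor
below `q₀`. -/
lemma exists_prime_gt_forall_not_dvd_sub_one (q₀ N : ℕ) :
    ∃ q > N, q.Prime ∧ q % 4 = 3 ∧ ∀ p : ℕ, p.Prime → p ≠ 2 → p < q₀ → ¬ p ∣ q - 1 := by
  set P : ℕ := ∏ p ∈ (Finset.range q₀).filter (fun p => p.Prime ∧ p ≠ 2), p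
  have hodd : Odd P := by
    refine Finset.prod_induction _ Odd (fun _ _ => Odd.mul) odd_one fun p hp => ?_
    obtain ⟨-, hp, h2⟩ := Finset.mem_filter.1 hp
    exact hp.odd_of_ne_two h2
  have hmod : (P * P) % 4 = 1 := by
    rcases Nat.odd_mod_four_iff.1 (Nat.odd_iff.1 hodd) with h | h <;> simp [Nat.mul_mod, h]
  have hodd2 : Odd (P * P + 2) := (hodd.mul hodd).add_even even_two
  have hcop : (P * P + 2).Coprime (4 * P) := by
    refine Nat.Coprime.mul_right ?_ ?_
    · exact (hodd2.coprime_two_right.pow_right 2 : Nat.Coprime _ (2 ^ 2))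
    · simpa using hodd.coprime_two_left
  have hP0 : 4 * P ≠ 0 := by
    have := hodd.pos
    omega
  obtain ⟨q, hqN, hq, hqa⟩ := Nat.forall_exists_prime_gt_and_modEq N hP0 hcop
  refine ⟨q, hqN, hq, ?_, fun p hp hp2 hpq₀ hd => ?_⟩
  · have : q % 4 = (P * P + 2) % 4 := hqa.of_mul_right P
    omega
  · have hpP : p ∣ P := Finset.dvd_prod_of_mem (fun p => p)
      (Finset.mem_filter.2 ⟨Finset.mem_range.2 hpq₀, hp, hp2⟩)
    have h2 : q ≡ P * P + 2 [MOD p] := (hqa.of_mul_left 4).of_dvd hpP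
    have h1 : q ≡ 1 [MOD p] := ((Nat.modEq_iff_dvd' hq.one_lt.le).2 hd).symm
    have h3 : 0 + 1 ≡ (P * P + 1) + 1 [MOD p] := h1.symm.trans h2
    have h4 : p ∣ P * P + 1 := (Nat.modEq_zero_iff_dvd).1 (h3.add_right_cancel' 1).symm
    exact hp.one_lt.ne' (Nat.dvd_one.1 ((Nat.dvd_add_right (hpP.mul_right P)).1 h4))

theorem infinite_A_good_and_B_good_primes (q₀ : ℕ) (hq₀ : 3 ≤ q₀) :
    {q : ℕ | q.Prime ∧ IsAGood q₀ q ∧ IsBGood q₀ q}.Infinite := by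
  refine Set.infinite_of_forall_exists_gt fun N => ?_
  obtain ⟨q, hqN, hq, h4, hr⟩ := exists_prime_gt_forall_not_dvd_sub_one q₀ N
  have hk : q / q₀ ≤ q / 3 := Nat.div_le_div_left hq₀ (by norm_num)
  refine ⟨q, ⟨hq, fun H hneg hH => ?_, fun H hneg hH => ?_⟩, hqN⟩
  · have h1 := hneg 1 H.one_mem
    refine eq_top_of_div_lt_card (by omega) hq h4 hr H h1
      (lt_card_of_neg_one_mem hq H h1 (fun n => n) (Set.injOn_id _) ?_ ?_ hH) <;>
    · intro n hn
      have := Finset.mem_Icc.1 hn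
      omega
  · have h1 := hneg 1 H.one_mem
    refine eq_top_of_div_lt_card (by omega) hq h4 hr H h1
      (lt_card_of_neg_one_mem hq H h1 (fun n => 2 * n - 1) ?_ ?_ ?_ hH)
    · intro a ha b hb hab
      have := Finset.mem_Icc.1 ha
      have := Finset.mem_Icc.1 hb
      simp only at hab
      omega
    all_goals
      intro n hn
      have := Finset.mem_Icc.1 hn
      omega
end

section
/- For every integer l ≥ 3, there exist infinitely many primes q with the following property: letting t be the smallest odd positive integer with t^l ≥ q (so that t < q), the smallest subgroup of the unit group (ℤ/qℤ)* that is closed under negation and contains the residue classes of all odd integers 1, 3, 5, …, t is all of (ℤ/qℤ)*. -/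
open ArithmeticFunction in
theorem log_factorial_eq_sum_vonMangoldt (n : ℕ) :
    Real.log (n.factorial : ℝ) = ∑ d ∈ Finset.Ioc 0 n, vonMangoldt d * (n / d : ℕ) := by
  rw [← sum_Ioc_mul_zeta_eq_sum, vonMangoldt_mul_zeta]
  induction n with
  | zero => simp
  | succ n ih =>
    rw [Nat.factorial_succ, Nat.cast_mul, Real.log_mul (by positivity) (by positivity), ih,
      Finset.sum_Ioc_succ_top (by omega), log_apply, add_comm]

open ArithmeticFunction in
/-- Upper half of Mertens' first theorem. -/
theorem sum_vonMangoldt_div_le {n : ℕ} (hn : 0 < n) :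
    ∑ d ∈ Finset.Ioc 0 n, vonMangoldt d / d ≤ Real.log n + (Real.log 4 + 4) := by
  have hn' : (0 : ℝ) < n := by exact_mod_cast hn
  have hpsi : ∑ d ∈ Finset.Ioc 0 n, vonMangoldt d ≤ (Real.log 4 + 4) * n := by
    have := Chebyshev.psi_le_const_mul_self hn'.le
    rwa [Chebyshev.psi, Nat.floor_natCast] at this
  have hlog : Real.log (n.factorial : ℝ) ≤ n * Real.log n := by
    rw [← Real.log_pow]
    exact Real.log_le_log (by positivity) (by exact_mod_cast n.factorial_le_pow)
  have key : n * ∑ d ∈ Finset.Ioc 0 n, vonMangoldt d / d ≤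
      Real.log (n.factorial : ℝ) + ∑ d ∈ Finset.Ioc 0 n, vonMangoldt d := by
    rw [log_factorial_eq_sum_vonMangoldt, ← Finset.sum_add_distrib, Finset.mul_sum]
    refine Finset.sum_le_sum fun d hd => ?_
    have h1 : (n : ℝ) / d ≤ (n / d : ℕ) + 1 := by
      rw [← Nat.floor_div_eq_div (K := ℝ)]
      exact (Nat.lt_floor_add_one _).le
    have := mul_le_mul_of_nonneg_left h1 (vonMangoldt_nonneg (n := d))
    calc (n : ℝ) * (vonMangoldt d / d) = vonMangoldt d * (n / d) := by ring
      _ ≤ _ := this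
      _ = _ := by ring
  refine le_of_mul_le_mul_left (a := (n : ℝ)) ?_ hn'
  linarith

open ArithmeticFunction in
/-- Lower half of Mertens' first theorem. -/
theorem log_sub_one_le_sum_vonMangoldt_div {n : ℕ} (hn : 0 < n) :
    Real.log n - 1 ≤ ∑ d ∈ Finset.Ioc 0 n, vonMangoldt d / d := by
  have hn' : (0 : ℝ) < n := by exact_mod_cast hn
  have hstir := Stirling.le_log_factorial_stirling hn.ne'
  have h0 : 0 ≤ Real.log n := Real.log_natCast_nonneg n
  have h1 : 0 ≤ Real.log (2 * Real.pi) := Real.log_nonneg (by linarith [Real.pi_gt_three])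
  have key : Real.log (n.factorial : ℝ) ≤ n * ∑ d ∈ Finset.Ioc 0 n, vonMangoldt d / d := by
    rw [log_factorial_eq_sum_vonMangoldt, Finset.mul_sum]
    refine Finset.sum_le_sum fun d hd => ?_
    have := mul_le_mul_of_nonneg_left (Nat.cast_div_le (α := ℝ) (m := n) (n := d))
      (vonMangoldt_nonneg (n := d))
    calc _ ≤ _ := this
      _ = _ := by ring
  refine le_of_mul_le_mul_left (a := (n : ℝ)) ?_ hn'
  linarith

open ArithmeticFunction in
theorem sum_even_vonMangoldt_div_le (n : ℕ) :
    ∑ d ∈ Finset.Ioc 0 n with ¬ Odd d, vonMangoldt d / d ≤ 2 * Real.log 2 := by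
  have hlog : 0 ≤ Real.log 2 := Real.log_nonneg (by norm_num)
  have hpow : ∀ d : ℕ, ¬ Odd d → vonMangoldt d / d ≠ 0 → ∃ k ≠ 0, d = 2 ^ k := by
    intro d hd h0
    have hpp : IsPrimePow d := by
      by_contra h
      exact h0 (by rw [vonMangoldt_eq_zero_iff.2 h, zero_div])
    obtain ⟨p, k, hp, hk, rfl⟩ := (isPrimePow_nat_iff _).1 hpp
    obtain rfl : 2 = p := (Nat.prime_dvd_prime_iff_eq Nat.prime_two hp).1
      (Nat.prime_two.dvd_of_dvd_pow (Nat.not_odd_iff_even.1 hd).two_dvd)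
    exact ⟨k, hk.ne', rfl⟩
  calc ∑ d ∈ Finset.Ioc 0 n with ¬ Odd d, vonMangoldt d / d
      = ∑ d ∈ (Finset.Ioc 0 n).filter (fun d => ¬ Odd d) with vonMangoldt d / (d : ℝ) ≠ 0,
          vonMangoldt d / d := (Finset.sum_filter_ne_zero _).symm
    _ ≤ ∑ d ∈ (Finset.Ioc 0 n).filter (fun d => ¬ Odd d) with vonMangoldt d / (d : ℝ) ≠ 0,
          Real.log 2 / d := by
        refine Finset.sum_le_sum fun d hd => ?_
        simp only [Finset.mem_filter] at hd
        obtain ⟨k, hk, rfl⟩ := hpow d hd.1.2 hd.2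
        rw [vonMangoldt_apply_pow hk, vonMangoldt_apply_prime Nat.prime_two, Nat.cast_two]
    _ ≤ ∑ d ∈ (Finset.range (n + 1)).image fun k : ℕ => (2 ^ k : ℕ), Real.log 2 / (d : ℝ) := by
        refine Finset.sum_le_sum_of_subset_of_nonneg (fun d hd => ?_) fun d _ _ => by positivity
        simp only [Finset.mem_filter, Finset.mem_Ioc] at hd
        obtain ⟨k, hk, rfl⟩ := hpow d hd.1.2 hd.2
        have := k.lt_two_pow_self
        simp only [Finset.mem_image, Finset.mem_range]
        exact ⟨k, by omega, rfl⟩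
    _ = Real.log 2 * ∑ k ∈ Finset.range (n + 1), (1 / (2 : ℝ)) ^ k := by
        rw [Finset.sum_image fun a _ b _ h => Nat.pow_right_injective le_rfl h, Finset.mul_sum]
        refine Finset.sum_congr rfl fun k _ => ?_
        simp [div_eq_mul_inv]
    _ ≤ Real.log 2 * 2 := by gcongr; exact sum_geometric_two_le _
    _ = 2 * Real.log 2 := mul_comm _ _

open ArithmeticFunction in
theorem exists_le_sum_odd_vonMangoldt_div :
    ∃ C : ℝ, ∀ a b : ℕ, 0 < a → 0 < b →
      Real.log b - Real.log a - C ≤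
        ∑ d ∈ Finset.Ioc a b with Odd d, vonMangoldt d / d := by
  refine ⟨1 + (Real.log 4 + 4) + 2 * Real.log 2, fun a b ha hb => ?_⟩
  have h1 := log_sub_one_le_sum_vonMangoldt_div hb
  have h2 := sum_vonMangoldt_div_le ha
  have h3 := sum_even_vonMangoldt_div_le b
  rw [← Finset.sum_filter_add_sum_filter_not _ (fun d => Odd d)] at h1
  have h4 : ∑ d ∈ Finset.Ioc 0 b with Odd d, vonMangoldt d / d ≤
      ∑ d ∈ Finset.Ioc 0 a, vonMangoldt d / d +
        ∑ d ∈ Finset.Ioc a b with Odd d, vonMangoldt d / d := by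
    rw [← Finset.sum_union]
    · refine Finset.sum_le_sum_of_subset_of_nonneg (fun d hd => ?_)
        fun d _ _ => div_nonneg vonMangoldt_nonneg (Nat.cast_nonneg d)
      simp only [Finset.mem_filter, Finset.mem_Ioc, Finset.mem_union] at hd ⊢
      by_cases h : d ≤ a <;> simp [h, hd]; omega
    · rw [Finset.disjoint_left]
      intro d hd hd'
      simp only [Finset.mem_filter, Finset.mem_Ioc] at hd hd'
      omega
  linarith

open scoped Classical in
theorem div_four_le_card_odd_multiples {X P : ℕ} (hP : 0 < P) (hPX : P ≤ X) :
    (X : ℝ) / (4 * P) ≤ ((Finset.Icc 1 X).filter fun n => ∃ m, Odd m ∧ n = m * P).card := by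
  set k := X / P with hk
  have hk1 : 1 ≤ k := (Nat.one_le_div_iff hP).2 hPX
  have hcard : (k + 1) / 2 ≤
      ((Finset.Icc 1 X).filter fun n => ∃ m, Odd m ∧ n = m * P).card := by
    calc (k + 1) / 2 = ((Finset.range ((k + 1) / 2)).image fun j => (2 * j + 1) * P).card := by
          rw [Finset.card_image_of_injective, Finset.card_range]
          intro i j h
          have := Nat.eq_of_mul_eq_mul_right hP h
          omega
      _ ≤ _ := by
          refine Finset.card_le_card fun n hn => ?_
          simp only [Finset.mem_image, Finset.mem_range] at hn
          obtain ⟨j, hj, rfl⟩ := hn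
          simp only [Finset.mem_filter, Finset.mem_Icc]
          refine ⟨⟨Nat.mul_pos (by omega) hP, ?_⟩, 2 * j + 1, ⟨j, rfl⟩, rfl⟩
          exact (Nat.mul_le_mul_right P (by omega : 2 * j + 1 ≤ k)).trans (Nat.div_mul_le_self X P)
  have h1 : X < (k + 1) * P := by
    have := Nat.lt_mul_div_succ X hP
    rw [mul_comm]; exact this
  have h2 : X ≤ 4 * P * ((k + 1) / 2) := by
    have : k + 1 ≤ 4 * ((k + 1) / 2) := by omega
    calc X ≤ (k + 1) * P := h1.le
      _ ≤ 4 * ((k + 1) / 2) * P := Nat.mul_le_mul_right P this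
      _ = _ := by ring
  rw [div_le_iff₀ (by positivity)]
  calc (X : ℝ) ≤ (4 * P * ((k + 1) / 2) : ℕ) := by exact_mod_cast h2
    _ ≤ (4 * P * ((Finset.Icc 1 X).filter fun n => ∃ m, Odd m ∧ n = m * P).card : ℕ) := by
        exact_mod_cast Nat.mul_le_mul_left _ hcard
    _ = _ := by push_cast; ring

open ArithmeticFunction in
/-- A lower bound for the number of `n ≤ X` of the form `m * d₁ * ⋯ * dₗ`, with `m` and the
`dᵢ ∈ D` odd, obtained by weighting each factorisation with `Λ d₁ * ⋯ * Λ dₗ`. -/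
theorem mul_sum_vonMangoldt_pow_le_card {X l : ℕ} (D : Finset ℕ) (p : ℕ → Prop) [DecidablePred p]
    (hD : ∀ d ∈ D, 0 < d) (hX : ∀ d : Fin l → ℕ, (∀ i, d i ∈ D) → ∏ i, d i ≤ X)
    (hp : ∀ d : Fin l → ℕ, (∀ i, d i ∈ D) → ∀ m, Odd m → m * ∏ i, d i ≤ X → p (m * ∏ i, d i)) :
    X / 4 * (∑ d ∈ D, vonMangoldt d / d) ^ l ≤
      ((Finset.Icc 1 X).filter p).card * Real.log X ^ l := by
  have hnn : ∀ d : Fin l → ℕ, 0 ≤ ∏ i, vonMangoldt (d i) :=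
    fun d => Finset.prod_nonneg fun _ _ => vonMangoldt_nonneg
  calc X / 4 * (∑ d ∈ D, vonMangoldt d / d) ^ l
      = ∑ d ∈ Fintype.piFinset fun _ : Fin l => D,
          (∏ i, vonMangoldt (d i)) * (X / (4 * (∏ i, d i : ℕ))) := by
        rw [Finset.sum_pow', Finset.mul_sum]
        refine Finset.sum_congr rfl fun d _ => ?_
        rw [Finset.prod_div_distrib]
        push_cast
        ring
    _ ≤ ∑ d ∈ Fintype.piFinset fun _ : Fin l => D,
          ∑ n ∈ (Finset.Icc 1 X).filter p, if ∀ i, d i ∣ n then ∏ i, vonMangoldt (d i) else 0 := by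
        refine Finset.sum_le_sum fun d hd => ?_
        rw [Fintype.mem_piFinset] at hd
        rw [← Finset.sum_filter, Finset.sum_const, nsmul_eq_mul, mul_comm]
        refine mul_le_mul_of_nonneg_right ?_ (hnn d)
        refine (div_four_le_card_odd_multiples
          (Finset.prod_pos fun i _ => hD _ (hd i)) (hX d hd)).trans ?_
        refine Nat.cast_le (α := ℝ).2 (Finset.card_le_card fun n hn => ?_)
        simp only [Finset.mem_filter] at hn ⊢
        obtain ⟨hn, m, hm, rfl⟩ := hn
        exact ⟨⟨hn, hp d hd m hm (Finset.mem_Icc.1 hn).2⟩,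
          fun i => (Finset.dvd_prod_of_mem d (Finset.mem_univ i)).mul_left m⟩
    _ = ∑ n ∈ (Finset.Icc 1 X).filter p, ∑ d ∈ Fintype.piFinset fun _ : Fin l => D,
          if ∀ i, d i ∣ n then ∏ i, vonMangoldt (d i) else 0 := Finset.sum_comm
    _ ≤ ∑ n ∈ (Finset.Icc 1 X).filter p, Real.log X ^ l := by
        refine Finset.sum_le_sum fun n hn => ?_
        obtain ⟨hn1, hnX⟩ := Finset.mem_Icc.1 (Finset.mem_filter.1 hn).1
        rw [← Finset.sum_filter]
        calc _ ≤ ∑ d ∈ Fintype.piFinset fun _ : Fin l => n.divisors, ∏ i, vonMangoldt (d i) := by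
              refine Finset.sum_le_sum_of_subset_of_nonneg (fun d hd => ?_) fun d _ _ => hnn d
              rw [Fintype.mem_piFinset]
              exact fun i => Nat.mem_divisors.2 ⟨(Finset.mem_filter.1 hd).2 i, by omega⟩
          _ = Real.log n ^ l := by rw [← Finset.sum_pow', vonMangoldt_sum]
          _ ≤ Real.log X ^ l := by
              have : (0 : ℝ) < n := by exact_mod_cast hn1
              gcongr
    _ = _ := by rw [Finset.sum_const, nsmul_eq_mul]

/-- If a subgroup `H` of `(ℤ/qℤ)ˣ` contains all odd numbers up to roughly `q ^ (1 / l)`, then its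
index is bounded in terms of `l` alone, provided `q` is large. -/
theorem exists_index_le_of_odd_mem (l : ℕ) (hl : 0 < l) :
    ∃ Q : ℕ, ∀ q : ℕ, q.Prime → Q < q → ∀ t : ℕ, q ≤ t ^ l → (t - 2) ^ l < q → t < q →
      ∀ H : Subgroup (ZMod q)ˣ,
        (∀ u : (ZMod q)ˣ, (∃ n : ℕ, Odd n ∧ n ≤ t ∧ (u : ZMod q) = (n : ZMod q)) → u ∈ H) →
        H.index ≤ 4 * (2 * l ^ 2) ^ l := by
  classical
  obtain ⟨C, hC⟩ := exists_le_sum_odd_vonMangoldt_div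
  obtain ⟨T, hT⟩ := exists_nat_ge (Real.exp (2 * l * (Real.log 3 + C)))
  refine ⟨(T + 3) ^ l, fun q hq hQ t hqt htq htlt H hH => ?_⟩
  have : Fact q.Prime := ⟨hq⟩
  have hTt : T + 3 < t := lt_of_pow_lt_pow_left₀ l (Nat.zero_le t) (hQ.trans_le hqt)
  have ht0 : (0 : ℝ) < t := by exact_mod_cast (by omega : 0 < t)
  have ht1 : (1 : ℝ) < t := by exact_mod_cast (by omega : 1 < t)
  have hl0 : (0 : ℝ) < l := by exact_mod_cast hl
  have hlogt : 0 < Real.log t := Real.log_pos ht1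
  have hlogT : 2 * l * (Real.log 3 + C) ≤ Real.log t := by
    rw [Real.le_log_iff_exp_le ht0]
    exact hT.trans (by exact_mod_cast (by omega : T ≤ t))
  have he : 0 ≤ 1 - 1 / (l : ℝ) := by
    rw [sub_nonneg, div_le_one hl0]
    exact_mod_cast hl
  set z : ℝ := (t : ℝ) ^ (1 - 1 / (l : ℝ)) with hz
  have hz1 : 1 ≤ z := Real.one_le_rpow ht1.le he
  have hzl : z ^ l = (t : ℝ) ^ (l - 1) := by
    rw [hz, ← Real.rpow_natCast, ← Real.rpow_mul ht0.le, ← Real.rpow_natCast, Nat.cast_sub hl]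
    congr 1
    field_simp
    simp
  set a : ℕ := ⌊z⌋₊ with ha
  have ha0 : 0 < a := Nat.floor_pos.2 hz1
  have hloga : Real.log a ≤ (1 - 1 / (l : ℝ)) * Real.log t := by
    rw [← Real.log_rpow ht0]
    exact Real.log_le_log (by exact_mod_cast ha0) (Nat.floor_le (by linarith))
  have hlogb : Real.log t - Real.log 3 ≤ Real.log (t - 2 : ℕ) := by
    rw [← Real.log_div ht0.ne' (by norm_num)]
    refine Real.log_le_log (by positivity) ?_
    rw [div_le_iff₀ (by norm_num)]
    exact_mod_cast (by omega : t ≤ (t - 2) * 3)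
  set D := (Finset.Ioc a (t - 2)).filter fun d => Odd d with hDdef
  have hS : Real.log t / (2 * l) ≤ ∑ d ∈ D, ArithmeticFunction.vonMangoldt d / d := by
    have h1 := hC a (t - 2) ha0 (by omega)
    have h2 : Real.log 3 + C ≤ Real.log t / (2 * l) := by
      rw [le_div_iff₀ (by positivity)]
      linarith
    have h3 : (1 / (l : ℝ)) * Real.log t = 2 * (Real.log t / (2 * l)) := by
      field_simp
    linarith
  have hDmem : ∀ d ∈ D, z < d ∧ d ≤ t - 2 ∧ Odd d := by
    intro d hd
    simp only [hDdef, Finset.mem_filter, Finset.mem_Ioc] at hd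
    exact ⟨(Nat.floor_lt (by linarith)).1 hd.1.1, hd.1.2, hd.2⟩
  have hunit : ∀ n : ℕ, Odd n → n ≤ t → ∃ u ∈ H, (u : ZMod q) = n := by
    intro n hn hnt
    have hne : (n : ZMod q) ≠ 0 := by
      rw [Ne, ZMod.natCast_eq_zero_iff]
      exact Nat.not_dvd_of_pos_of_lt hn.pos (hnt.trans_lt htlt)
    exact ⟨Units.mk0 _ hne, hH _ ⟨n, hn, hnt, rfl⟩, rfl⟩
  set p : ℕ → Prop := fun n => ∃ u ∈ H, (u : ZMod q) = n with hp
  have hmain := mul_sum_vonMangoldt_pow_le_card (X := q - 1) (l := l) D p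
    (fun d hd => (hDmem d hd).2.2.pos)
    (fun d hd => by
      have : ∏ i, d i ≤ (t - 2) ^ l := by
        simpa using Finset.prod_le_pow_card Finset.univ d (t - 2) fun i _ => (hDmem _ (hd i)).2.1
      omega)
    (fun d hd m hm hmX => by
      have hlow : t ^ (l - 1) ≤ ∏ i, d i := by
        have : z ^ l ≤ ∏ i, (d i : ℝ) := by
          rw [← Fin.prod_const]
          exact Finset.prod_le_prod (fun _ _ => by linarith) fun i _ => (hDmem _ (hd i)).1.le
        rw [hzl] at this
        exact_mod_cast this
      have hmt : m ≤ t := by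
        have h1 : m * t ^ (l - 1) ≤ q - 1 := (Nat.mul_le_mul_left m hlow).trans hmX
        have h2 : t * t ^ (l - 1) = t ^ l := by rw [← pow_succ', Nat.sub_add_cancel hl]
        have h3 : m * t ^ (l - 1) < t * t ^ (l - 1) := by
          have := hq.pos
          omega
        exact (Nat.lt_of_mul_lt_mul_right h3).le
      obtain ⟨u, hu, hum⟩ := hunit m hm hmt
      choose v hv hvd using fun i => hunit (d i) (hDmem _ (hd i)).2.2
        ((hDmem _ (hd i)).2.1.trans (Nat.sub_le t 2))
      exact ⟨u * ∏ i, v i, H.mul_mem hu (H.prod_mem fun i _ => hv i), by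
        push_cast
        rw [hum]
        simp only [hvd]⟩)
  have hA : ((Finset.Icc 1 (q - 1)).filter p).card ≤ Nat.card H := by
    have hsub : ((Finset.Icc 1 (q - 1)).filter p).image (fun n : ℕ => (n : ZMod q)) ⊆
        (Finset.univ.filter fun u : (ZMod q)ˣ => u ∈ H).image fun u : (ZMod q)ˣ => (u : ZMod q) := by
      intro x hx
      simp only [hp, Finset.mem_image, Finset.mem_filter] at hx
      obtain ⟨n, ⟨-, u, hu, hun⟩, rfl⟩ := hx
      simp only [Finset.mem_image, Finset.mem_filter, Finset.mem_univ, true_and]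
      exact ⟨u, hu, hun⟩
    have hinj : Set.InjOn (fun n : ℕ => (n : ZMod q)) ((Finset.Icc 1 (q - 1)).filter p) := by
      intro x hx y hy hxy
      simp only [Finset.coe_filter, Finset.mem_Icc, Set.mem_ofPred_eq] at hx hy
      have := hq.pos
      have h := (ZMod.natCast_eq_natCast_iff' _ _ _).1 hxy
      rwa [Nat.mod_eq_of_lt (by omega), Nat.mod_eq_of_lt (by omega)] at h
    rw [← Finset.card_image_of_injOn hinj]
    refine (Finset.card_le_card hsub).trans (Finset.card_image_le.trans (le_of_eq ?_))
    rw [Nat.card_eq_fintype_card, Fintype.card_subtype]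
  have hcard : Nat.card H * H.index = q - 1 := by
    rw [H.card_mul_index, Nat.card_eq_fintype_card, ZMod.card_units]
  have hHpos : 0 < Nat.card H := Nat.card_pos
  have hlogX : Real.log (q - 1 : ℕ) ≤ 2 * l ^ 2 * (Real.log t / (2 * l)) := by
    have h1 : (0 : ℝ) < (q - 1 : ℕ) := by exact_mod_cast (by omega : 0 < q - 1)
    calc Real.log (q - 1 : ℕ) ≤ Real.log ((t : ℝ) ^ l) :=
          Real.log_le_log h1 (by exact_mod_cast (by omega : q - 1 ≤ t ^ l))
      _ = l * Real.log t := Real.log_pow _ _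
      _ = _ := by field_simp
  set L := Real.log t / (2 * l) with hL
  have hL0 : 0 < L := by positivity
  have hfin : ((q - 1 : ℕ) : ℝ) / 4 * L ^ l ≤ Nat.card H * (2 * l ^ 2) ^ l * L ^ l := by
    calc ((q - 1 : ℕ) : ℝ) / 4 * L ^ l
        ≤ (q - 1 : ℕ) / 4 * (∑ d ∈ D, ArithmeticFunction.vonMangoldt d / d) ^ l := by gcongr
      _ ≤ _ := hmain
      _ ≤ Nat.card H * (2 * l ^ 2 * L) ^ l := by
          have := Real.log_natCast_nonneg (q - 1)
          gcongr
      _ = _ := by rw [mul_pow _ L]; ring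
  have hfin' := le_of_mul_le_mul_right hfin (pow_pos hL0 l)
  rw [← hcard] at hfin'
  have : Nat.card H * H.index ≤ Nat.card H * (4 * (2 * l ^ 2) ^ l) := by
    have h : (Nat.card H * H.index : ℝ) ≤ Nat.card H * (4 * (2 * l ^ 2) ^ l) := by
      push_cast at hfin'
      linarith
    exact_mod_cast h
  exact Nat.le_of_mul_le_mul_left this hHpos

/-- If `q ≡ -1` modulo `4 * N!`, then `q - 1` has no odd prime factor up to `N` and `-1` is not a
square, so a subgroup containing `-1` of index at most `N` is everything. -/
theorem eq_top_of_index_le {q N : ℕ} (hq : q.Prime) (hN : 4 * N.factorial ∣ q + 1)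
    (H : Subgroup (ZMod q)ˣ) (hneg : -1 ∈ H) (hindex : H.index ≤ N) : H = ⊤ := by
  have : Fact q.Prime := ⟨hq⟩
  have h4 : 4 ∣ q + 1 := (Dvd.intro _ rfl).trans hN
  have hcard : Nat.card H * H.index = q - 1 := by
    rw [H.card_mul_index, Nat.card_eq_fintype_card, ZMod.card_units]
  have hodd : 2 < q := by
    have := hq.two_le
    omega
  have h2 : 2 ∣ Nat.card H := by
    have : Fact (2 < q) := ⟨hodd⟩
    have hord : orderOf (⟨-1, hneg⟩ : H) = 2 := by
      refine orderOf_eq_prime (by ext; simp) fun h => ?_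
      have h' : (-1 : (ZMod q)ˣ) = 1 := congrArg Subtype.val h
      exact ZMod.neg_one_ne_one (n := q) (by simpa using congrArg Units.val h')
    rw [← hord]
    exact orderOf_dvd_natCard _
  rw [← Subgroup.index_eq_one]
  by_contra hne
  obtain ⟨p, hp, hpi⟩ := Nat.exists_prime_and_dvd hne
  have hi0 : 0 < H.index := Nat.pos_of_ne_zero H.index_ne_zero_of_finite
  have hpN : p ∣ q + 1 :=
    ((hp.dvd_factorial.2 ((Nat.le_of_dvd hi0 hpi).trans hindex)).mul_left 4).trans hN
  have hpq : p ∣ q - 1 := hcard ▸ hpi.mul_left _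
  have hp2 : p ∣ 2 := by
    have := Nat.dvd_sub hpN hpq
    rwa [show q + 1 - (q - 1) = 2 by omega] at this
  obtain rfl : p = 2 := (Nat.prime_dvd_prime_iff_eq hp Nat.prime_two).1 hp2
  have : 2 * 2 ∣ q - 1 := hcard ▸ mul_dvd_mul h2 hpi
  omega

/-- There are infinitely many `l`-C-good primes: primes `q` such that, for `t` the
smallest odd positive integer with `t^l ≥ q`, we have `t < q` and the smallest
negation-closed subgroup of `(ℤ/qℤ)*` containing the residues of the odd numbers
`1, 3, …, t` is the whole unit group. -/
theorem infinite_l_C_good_primes (l : ℕ) (hl : 3 ≤ l) :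
    {q : ℕ | q.Prime ∧
      ∀ t : ℕ, Odd t → q ≤ t ^ l → (∀ s : ℕ, Odd s → q ≤ s ^ l → t ≤ s) →
        t < q ∧
        ∀ H : Subgroup (ZMod q)ˣ, (∀ x ∈ H, -x ∈ H) →
          (∀ u : (ZMod q)ˣ,
            (∃ n : ℕ, Odd n ∧ n ≤ t ∧ (u : ZMod q) = (n : ZMod q)) → u ∈ H) →
          H = ⊤}.Infinite := by
  obtain ⟨Q, hQ⟩ := exists_index_le_of_odd_mem l (by omega)
  set N := 4 * (2 * l ^ 2) ^ l
  rw [Set.infinite_iff_exists_gt]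
  intro n
  have hM : 0 < 4 * N.factorial := by positivity
  have hcop : (4 * N.factorial - 1).Coprime (4 * N.factorial) :=
    (Nat.coprime_self_sub_left hM).2 (Nat.coprime_one_left _)
  obtain ⟨q, hqn, hq, hmod⟩ := Nat.forall_exists_prime_gt_and_modEq (n + Q + 5) hM.ne' hcop
  have hdvd : 4 * N.factorial ∣ q + 1 := by
    have := hmod.add_right 1
    rw [Nat.sub_add_cancel hM] at this
    exact (Nat.modEq_zero_iff_dvd.1 (this.trans (by simp [Nat.ModEq])))
  have hqodd : Odd q := hq.odd_of_ne_two (by omega)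
  refine ⟨q, ⟨hq, fun t ht hqt hmin => ?_⟩, by omega⟩
  have htlt : t < q := by
    have : t ≤ q - 2 := by
      refine hmin _ (Nat.Odd.sub_even (by omega) hqodd even_two) ?_
      calc q ≤ (q - 2) ^ 2 := by
            obtain ⟨r, rfl⟩ := Nat.exists_eq_add_of_le (by omega : 5 ≤ q)
            rw [show 5 + r - 2 = 3 + r by omega]
            nlinarith
        _ ≤ (q - 2) ^ l := Nat.pow_le_pow_right (by omega) (by omega)
    omega
  refine ⟨htlt, fun H hneg hH => ?_⟩
  have ht2 : (t - 2) ^ l < q := by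
    by_contra! h
    have ht3 : 2 < t := by
      by_contra! h'
      rw [Nat.sub_eq_zero_of_le h', zero_pow (by omega)] at h
      omega
    have := hmin (t - 2) (Nat.Odd.sub_even ht3.le ht even_two) h
    omega
  exact eq_top_of_index_le hq hdvd H (hneg 1 H.one_mem) (hQ q hq (by omega) t hqt ht2 htlt H hH)
end
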